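/- arXiv:2202.04792 — 5 statements merged into one kernel-verified Lean document; each statement's English description precedes it below -/
import Mathlib

section
/- Let R be a commutative Noetherian local ring, M a nonzero finitely generated R-module such that M_p is free over R_p for every associated prime p of R, M ≅ Ω^q M for some even integer q ≥ 2, and M is Tor-rigid. Then M ⊗_R Hom_R(M,R) has a nonzero torsion submodule. -/
open CategoryTheory IsLocalRing

noncomputable section

variable (R : Type) [CommRing R]

/-- `Tor_i^R(M,N)` as a type. -/
abbrev TorM (i : ℕ) (M N : Type) [AddCommGroup M] [Module R M]
    [AddCommGroup N] [Module R N] : Type :=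
  ((Tor (ModuleCat R) i).obj (ModuleCat.of R M)).obj (ModuleCat.of R N)

/-- `Ext^i_R(M,N)` as a type. -/
abbrev ExtM (i : ℕ) (M N : Type) [AddCommGroup M] [Module R M]
    [AddCommGroup N] [Module R N] : Type :=
  ((Ext R (ModuleCat R) i).obj (Opposite.op (ModuleCat.of R M))).obj (ModuleCat.of R N)

/-- `M` is isomorphic to its `q`-th syzygy `Ω^q M` in a minimal free resolution. -/
def IsPeriodicSyzygy [IsLocalRing R] (M : Type) [AddCommGroup M] [Module R M]
    (q : ℕ) : Prop :=
  ∃ (n : ℕ → ℕ) (d : ∀ i : ℕ, ((Fin (n (i + 1)) → R) →ₗ[R] (Fin (n i) → R)))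
    (g : (Fin (n 0) → R) →ₗ[R] M),
    Function.Surjective g ∧
    LinearMap.ker g = LinearMap.range (d 0) ∧
    (∀ i, LinearMap.ker (d i) = LinearMap.range (d (i + 1))) ∧
    LinearMap.ker g ≤ (maximalIdeal R) • (⊤ : Submodule R (Fin (n 0) → R)) ∧
    (∀ i, LinearMap.range (d i) ≤ (maximalIdeal R) • (⊤ : Submodule R (Fin (n i) → R))) ∧
    Nonempty (M ≃ₗ[R] LinearMap.range (d (q - 1)))

/-- `M` is locally free on the punctured spectrum of the local ring `R`. -/
def LocFreePunctured [IsLocalRing R] (M : Type) [AddCommGroup M] [Module R M] : Prop :=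
  ∀ (p : Ideal R) (_ : p.IsPrime), p ≠ maximalIdeal R →
    Module.Free (Localization.AtPrime p) (LocalizedModule p.primeCompl M)

/-- index type parametrizing all finitely generated `R`-modules (via presentations) -/
abbrev FGIdx := Σ n : ℕ, Submodule R (Fin n → R)

abbrev idxMod (x : FGIdx R) : Type := (Fin x.1 → R) ⧸ x.2

/-- relations (from short exact sequences) defining the Grothendieck group, ℚ-coefficients -/
def gRelQ : Set (FGIdx R →₀ ℚ) :=
  { v | ∃ (x y z : FGIdx R) (f : idxMod R x →ₗ[R] idxMod R y)
      (g : idxMod R y →ₗ[R] idxMod R z),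
      Function.Injective f ∧ Function.Surjective g ∧
      LinearMap.range f = LinearMap.ker g ∧
      v = Finsupp.single y 1 - Finsupp.single x 1 - Finsupp.single z 1 }

/-- relations defining the reduced Grothendieck group with ℚ-coefficients:
SES relations together with the class of `R` itself. -/
def gRelQbar : Set (FGIdx R →₀ ℚ) :=
  gRelQ R ∪ { v | ∃ x : FGIdx R, Nonempty (idxMod R x ≃ₗ[R] R) ∧ v = Finsupp.single x 1 }

/-- The reduced Grothendieck group with rational coefficients `Ḡ(R)_ℚ`. -/
abbrev GbarQ : Type := (FGIdx R →₀ ℚ) ⧸ Submodule.span ℚ (gRelQbar R)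

/-- `[N] = 0` in the reduced Grothendieck group with rational coefficients. -/
def ClassZeroQ (N : Type) [AddCommGroup N] [Module R N] : Prop :=
  ∀ x : FGIdx R, Nonempty (idxMod R x ≃ₗ[R] N) →
    (Submodule.Quotient.mk (p := Submodule.span ℚ (gRelQbar R))
      (Finsupp.single x 1) : GbarQ R) = 0

/-- relations (from short exact sequences) defining the Grothendieck group `G(R)` -/
def gRelZ : Set (FGIdx R →₀ ℤ) :=
  { v | ∃ (x y z : FGIdx R) (f : idxMod R x →ₗ[R] idxMod R y)
      (g : idxMod R y →ₗ[R] idxMod R z),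
      Function.Injective f ∧ Function.Surjective g ∧
      LinearMap.range f = LinearMap.ker g ∧
      v = Finsupp.single y 1 - Finsupp.single x 1 - Finsupp.single z 1 }

/-- The Grothendieck group `G(R)` of finitely generated `R`-modules. -/
abbrev GZ : Type := (FGIdx R →₀ ℤ) ⧸ Submodule.span ℤ (gRelZ R)

open Classical in
noncomputable def gcl (N : Type) [AddCommGroup N] [Module R N] : GZ R :=
  if h : ∃ x : FGIdx R, Nonempty (idxMod R x ≃ₗ[R] N) then
    Submodule.Quotient.mk (p := Submodule.span ℤ (gRelZ R)) (Finsupp.single h.choose 1)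
  else 0

/-- `[N] = 0` in the Grothendieck group `G(R)`. -/
def ClassZeroZ (N : Type) [AddCommGroup N] [Module R N] : Prop :=
  ∀ x : FGIdx R, Nonempty (idxMod R x ≃ₗ[R] N) →
    (Submodule.Quotient.mk (p := Submodule.span ℤ (gRelZ R))
      (Finsupp.single x 1) : GZ R) = 0

/-- the residue field of a local ring, as an `R`-module -/
abbrev resF [IsLocalRing R] : Type := R ⧸ (maximalIdeal R)

/-- `R` is a Gorenstein local ring of Krull dimension `d`
(characterized by `Ext^i_R(k,R) = 0` for `i ≠ d` and `Ext^d_R(k,R) ≅ k`). -/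
def IsGorensteinOfDim [IsLocalRing R] (d : ℕ) : Prop :=
  ringKrullDim R = d ∧
  (∀ i : ℕ, i ≠ d → Subsingleton (ExtM R i (resF R) R)) ∧
  Nonempty ((ExtM R d (resF R) R) ≃ₗ[R] resF R)

/-- `R` is a Cohen-Macaulay local ring of Krull dimension `d` (depth R = dim R = d,
depth computed via `Ext^i(k,R)`). -/
def IsCMOfDim [IsLocalRing R] (d : ℕ) : Prop :=
  ringKrullDim R = d ∧
  (∀ i : ℕ, i < d → Subsingleton (ExtM R i (resF R) R)) ∧
  Nontrivial (ExtM R d (resF R) R)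

/-- `ω` is a canonical module of the `d`-dimensional Cohen-Macaulay local ring `R`. -/
def IsCanonicalModule [IsLocalRing R] (d : ℕ) (ω : Type) [AddCommGroup ω] [Module R ω] : Prop :=
  Module.Finite R ω ∧
  (∀ i : ℕ, i ≠ d → Subsingleton (ExtM R i (resF R) ω)) ∧
  Nonempty ((ExtM R d (resF R) ω) ≃ₗ[R] resF R)

/-- `M` has depth `d` and is maximal Cohen-Macaulay over the `d`-dimensional local ring `R`
(depth computed via `Ext^i(k,M)`). -/
def IsMCM [IsLocalRing R] (d : ℕ) (M : Type) [AddCommGroup M] [Module R M] : Prop :=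
  (∀ i : ℕ, i < d → Subsingleton (ExtM R i (resF R) M)) ∧
  Nontrivial (ExtM R d (resF R) M)

/-- `M` has a free resolution of length at most `k` (so `pd_R M ≤ k`). -/
def PdLE (M : Type) [AddCommGroup M] [Module R M] (k : ℕ) : Prop :=
  ∃ (n : ℕ → ℕ) (d : ∀ i : ℕ, ((Fin (n (i + 1)) → R) →ₗ[R] (Fin (n i) → R)))
    (g : (Fin (n 0) → R) →ₗ[R] M),
    Function.Surjective g ∧
    LinearMap.ker g = LinearMap.range (d 0) ∧
    (∀ i, LinearMap.ker (d i) = LinearMap.range (d (i + 1))) ∧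
    (∀ i, k < i → n i = 0)

/-- `G` is a totally reflexive `R`-module. -/
def IsTotallyReflexive (G : Type) [AddCommGroup G] [Module R G] : Prop :=
  Module.Finite R G ∧
  Function.Bijective (Module.Dual.eval R G) ∧
  (∀ i : ℕ, 1 ≤ i → Subsingleton (ExtM R i G R)) ∧
  (∀ i : ℕ, 1 ≤ i → Subsingleton (ExtM R i (Module.Dual R G) R))

/-- `M` has a resolution by totally reflexive modules of length at most `g`
(so `Gdim_R M ≤ g`). -/
def GdimLE (M : Type) [AddCommGroup M] [Module R M] (g : ℕ) : Prop :=
  ∃ (G : ℕ → ModuleCat R) (d : ∀ i : ℕ, ((G (i + 1) : Type) →ₗ[R] (G i : Type)))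
    (ε : (G 0 : Type) →ₗ[R] M),
    (∀ i, IsTotallyReflexive R (G i)) ∧
    Function.Surjective ε ∧
    LinearMap.ker ε = LinearMap.range (d 0) ∧
    (∀ i, LinearMap.ker (d i) = LinearMap.range (d (i + 1))) ∧
    (∀ i, g < i → Subsingleton (G i : Type))

open Classical in
noncomputable def mlen (M : Type) [AddCommGroup M] [Module R M] : ℕ :=
  if h : ∃ s : CompositionSeries (Submodule R M), s.head = ⊥ ∧ s.last = ⊤ then
    h.choose.length
  else 0

/-- Hochster's theta invariant `θ(M,N)` computed using `Tor_{2n}` and `Tor_{2n-1}`. -/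
noncomputable def theta (M N : Type) [AddCommGroup M] [Module R M]
    [AddCommGroup N] [Module R N] (n : ℕ) : ℤ :=
  (mlen R (TorM R (2 * n) M N) : ℤ) - (mlen R (TorM R (2 * n - 1) M N) : ℤ)

/-- `C` has rank `r`: localization at every associated prime of `R` is free of rank `r`. -/
def HasRankN (C : Type) [AddCommGroup C] [Module R C] (r : ℕ) : Prop :=
  ∀ (p : Ideal R) (_ : p.IsPrime), p ∈ associatedPrimes R R →
    Nonempty ((LocalizedModule p.primeCompl C) ≃ₗ[Localization.AtPrime p]
      (Fin r → Localization.AtPrime p))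

end



section
variable {R : Type} [CommRing R]

noncomputable def resCx (X : ℕ → ModuleCat.{0} R) (d : ∀ i, X (i+1) →ₗ[R] X i)
    (hd : ∀ i, Function.Exact (d (i+1)) (d i)) : ChainComplex (ModuleCat.{0} R) ℕ :=
  ChainComplex.of X (fun i => ModuleCat.ofHom (d i)) (fun i => by
    ext x
    simpa using (hd i).apply_apply_eq_zero x)

lemma resCx_d (X : ℕ → ModuleCat.{0} R) (d : ∀ i, X (i+1) →ₗ[R] X i)
    (hd : ∀ i, Function.Exact (d (i+1)) (d i)) (i : ℕ) :
    (resCx X d hd).d (i+1) i = ModuleCat.ofHom (d i) := by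
  exact ChainComplex.of_d (α := ℕ) X (fun i => ModuleCat.ofHom (d i)) i

lemma resCx_exactAt (X : ℕ → ModuleCat.{0} R) (d : ∀ i, X (i+1) →ₗ[R] X i)
    (hd : ∀ i, Function.Exact (d (i+1)) (d i)) (n : ℕ) :
    (resCx X d hd).ExactAt (n+1) := by
  rw [HomologicalComplex.exactAt_iff' _ (n + 1 + 1) (n + 1) n (by simp) (by simp)]
  rw [ShortComplex.ShortExact.moduleCat_exact_iff_function_exact]
  have h := hd n
  have h1 := resCx_d X d hd n
  have h2 := resCx_d X d hd (n+1)
  change Function.Exact ((resCx X d hd).d (n+1+1) (n+1)) ((resCx X d hd).d (n+1) n)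
  rw [h1, h2]
  exact h

noncomputable def resPR (X : ℕ → ModuleCat.{0} R) (d : ∀ i, X (i+1) →ₗ[R] X i)
    (hd : ∀ i, Function.Exact (d (i+1)) (d i)) (hp : ∀ i, Module.Projective R (X i))
    (N : ModuleCat.{0} R) (ε : X 0 →ₗ[R] N) (hε : Function.Surjective ε)
    (h0 : Function.Exact (d 0) ε) : ProjectiveResolution N where
  complex := resCx X d hd
  projective := fun n => by
    have := hp n
    exact (IsProjective.iff_projective (R := R) (X n)).mp this
  π := (ChainComplex.toSingle₀Equiv _ _).symm ⟨ModuleCat.ofHom ε, by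
    rw [resCx_d]
    ext x
    exact h0.apply_apply_eq_zero x⟩
  quasiIso := ⟨fun n => by
    cases n
    · rw [ChainComplex.quasiIsoAt₀_iff, ShortComplex.quasiIso_iff_of_zeros']
      · refine (ShortComplex.exact_and_epi_g_iff_of_iso (S₂ := ShortComplex.mk (ModuleCat.ofHom (d 0)) (ModuleCat.ofHom ε) (by ext x; exact h0.apply_apply_eq_zero x)) ?_).2 ⟨?_, ?_⟩
        · refine ShortComplex.isoMk (Iso.refl _) (Iso.refl _) (Iso.refl _) ?_ ?_
          · rfl
          · rfl
        · rw [ShortComplex.ShortExact.moduleCat_exact_iff_function_exact]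
          exact h0
        · exact (ModuleCat.epi_iff_surjective _).2 hε
      all_goals rfl
    · rw [quasiIsoAt_iff_exactAt']
      · apply resCx_exactAt
      · apply ChainComplex.exactAt_succ_single_obj⟩

lemma tor_iff (X : ℕ → ModuleCat.{0} R) (d : ∀ i, X (i+1) →ₗ[R] X i)
    (hd : ∀ i, Function.Exact (d (i+1)) (d i)) (hp : ∀ i, Module.Projective R (X i))
    (M N : Type) [AddCommGroup M] [Module R M] [AddCommGroup N] [Module R N]
    (ε : X 0 →ₗ[R] N) (hε : Function.Surjective ε)
    (h0 : Function.Exact (d 0) ε) (n : ℕ) :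
    Subsingleton (TorM R (n+1) M N) ↔
      Function.Exact ((d (n+1)).lTensor M) ((d n).lTensor M) := by
  let P := resPR X d hd hp (ModuleCat.of R N) ε hε h0
  let F := (MonoidalCategory.tensoringLeft (ModuleCat.{0} R)).obj (ModuleCat.of R M)
  have e := P.isoLeftDerivedObj F (n+1)
  have h1 : Subsingleton (TorM R (n+1) M N) ↔ Limits.IsZero ((F.leftDerived (n+1)).obj (ModuleCat.of R N)) :=
    (ModuleCat.isZero_iff_subsingleton (M := (F.leftDerived (n+1)).obj (ModuleCat.of R N))).symm
  rw [h1, e.isZero_iff]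
  erw [← HomologicalComplex.exactAt_iff_isZero_homology]
  rw [HomologicalComplex.exactAt_iff' _ (n + 1 + 1) (n + 1) n (by simp) (by simp)]
  rw [ShortComplex.ShortExact.moduleCat_exact_iff_function_exact]
  change Function.Exact (F.map ((resCx X d hd).d (n+1+1) (n+1))) (F.map ((resCx X d hd).d (n+1) n)) ↔ _
  rw [resCx_d, resCx_d]
  rfl

end

section
open TensorProduct

section
variable {R : Type} [CommRing R]
/-- the canonical free cover -/
noncomputable def cov (B : ModuleCat.{0} R) : (B →₀ R) →ₗ[R] B :=
  Finsupp.linearCombination R (id : B → B)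

/-- iterated kernels of canonical free covers -/
noncomputable def resK (A : Type) [AddCommGroup A] [Module R A] : ℕ → ModuleCat.{0} R
  | 0 => ModuleCat.of R A
  | n + 1 => ModuleCat.of R (LinearMap.ker (cov (resK A n)))

/-- existence of a free resolution -/
lemma exists_res (A : Type) [AddCommGroup A] [Module R A] :
    ∃ (X : ℕ → ModuleCat.{0} R) (d : ∀ i, X (i+1) →ₗ[R] X i) (ε : X 0 →ₗ[R] A),
      (∀ i, Module.Projective R (X i)) ∧ Function.Surjective ε ∧ Function.Exact (d 0) ε ∧
      ∀ i, Function.Exact (d (i+1)) (d i) := by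
  let K : ℕ → ModuleCat.{0} R := resK A
  let p : ∀ n, (K n →₀ R) →ₗ[R] K n := fun n => cov (K n)
  have hp : ∀ n, Function.Surjective (p n) := fun n => Finsupp.linearCombination_id_surjective R _
  let j : ∀ n, K (n+1) →ₗ[R] (K n →₀ R) := fun n => (LinearMap.ker (p n)).subtype
  have hj : ∀ n, Function.Injective (j n) := fun n => Subtype.val_injective
  have hjp : ∀ n, Function.Exact (j n) (p n) := fun n => LinearMap.exact_subtype_ker_map _
  refine ⟨fun n => ModuleCat.of R (K n →₀ R), fun n => (j n) ∘ₗ (p (n+1)), p 0, ?_, hp 0, ?_, ?_⟩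
  · intro i
    show Module.Projective R (K i →₀ R)
    infer_instance
  · intro x
    refine (hjp 0 x).trans ?_
    constructor
    · rintro ⟨y, rfl⟩
      obtain ⟨z, rfl⟩ := hp 1 y
      exact ⟨z, rfl⟩
    · rintro ⟨z, rfl⟩
      exact ⟨_, rfl⟩
  · intro n x
    refine (map_eq_zero_iff (j n) (hj n) (x := p (n+1) x)).trans ?_
    refine (hjp (n+1) x).trans ?_
    constructor
    · rintro ⟨y, rfl⟩
      obtain ⟨z, rfl⟩ := hp (n+2) y
      exact ⟨z, rfl⟩
    · rintro ⟨z, rfl⟩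
      exact ⟨_, rfl⟩

/-- dimension shift in the first variable. -/
lemma shift_chase (K F M : Type) [AddCommGroup K] [Module R K] [AddCommGroup F] [Module R F]
    [AddCommGroup M] [Module R M] [Module.Flat R F] (i : K →ₗ[R] F) (g : F →ₗ[R] M)
    (hg : Function.Surjective g) (hig : Function.Exact i g) (hi : Function.Injective i)
    (A B C D : Type) [AddCommGroup A] [Module R A] [AddCommGroup B] [Module R B]
    [AddCommGroup C] [Module R C] [AddCommGroup D] [Module R D] [Module.Flat R C]
    (a : A →ₗ[R] B) (b : B →ₗ[R] C) (c : C →ₗ[R] D)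
    (hab : Function.Exact a b) (hbc : Function.Exact b c)
    (hM : Function.Exact (a.lTensor M) (b.lTensor M)) :
    Function.Exact (b.lTensor K) (c.lTensor K) := by
  have hbcF : Function.Exact (b.lTensor F) (c.lTensor F) := Module.Flat.lTensor_exact F hbc
  have habF : Function.Exact (a.lTensor F) (b.lTensor F) := Module.Flat.lTensor_exact F hab
  have comm : ∀ {U V S T : Type} [AddCommGroup U] [Module R U] [AddCommGroup V] [Module R V]
    [AddCommGroup S] [Module R S] [AddCommGroup T] [Module R T] (u : U →ₗ[R] V) (s : S →ₗ[R] T)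
    (x : U ⊗[R] S), u.rTensor T (s.lTensor U x) = s.lTensor V (u.rTensor S x) := by
    intros U V S T _ _ _ _ _ _ _ _ u s x
    rw [← LinearMap.comp_apply, ← LinearMap.comp_apply, LinearMap.rTensor_comp_lTensor,
      LinearMap.lTensor_comp_rTensor]
  intro z
  constructor
  · intro hz
    have h1 : c.lTensor F (i.rTensor C z) = 0 := by rw [← comm, hz, map_zero]
    obtain ⟨w, hw⟩ := (hbcF _).1 h1
    have h2 : b.lTensor M (g.rTensor B w) = 0 := by
      rw [← comm, hw, ← LinearMap.comp_apply, ← LinearMap.rTensor_comp, hig.linearMap_comp_eq_zero]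
      simp
    obtain ⟨v, hv⟩ := (hM _).1 h2
    obtain ⟨v', rfl⟩ := LinearMap.rTensor_surjective A hg v
    have h3 : g.rTensor B (w - a.lTensor F v') = 0 := by
      rw [map_sub, comm, hv, sub_self]
    obtain ⟨u, hu⟩ := (rTensor_exact B hig hg _).1 h3
    refine ⟨u, ?_⟩
    apply Module.Flat.rTensor_preserves_injective_linearMap (M := C) i hi
    rw [comm, hu, map_sub, hw, habF.apply_apply_eq_zero, sub_zero]
  · rintro ⟨u, rfl⟩
    rw [← LinearMap.comp_apply, ← LinearMap.lTensor_comp, hbc.linearMap_comp_eq_zero]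
    simp

/-- kernel of `M ⊗ A → M ⊗ B` is torsion. -/
lemma inj_of_torsionFree [IsNoetherianRing R] (M A B : Type) [AddCommGroup M] [Module R M]
    [AddCommGroup A] [Module R A] [AddCommGroup B] [Module R B] 
    (hass : ∀ (p : Ideal R) (_ : p.IsPrime), p ∈ associatedPrimes R R →
      Module.Free (Localization.AtPrime p) (LocalizedModule p.primeCompl M))
    (f : A →ₗ[R] B) (hf : Function.Injective f)
    (ht : Submodule.torsion R (M ⊗[R] A) = ⊥) : Function.Injective (f.lTensor M) := by
  rw [injective_iff_map_eq_zero]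
  intro x hx
  rw [← Submodule.mem_bot R, ← ht]
  by_contra hcon
  have hsub : ((R ∙ x).annihilator : Set R) ⊆ ⋃ p ∈ associatedPrimes R R, (p : Set R) := by
    rw [biUnion_associatedPrimes_eq_compl_nonZeroDivisors]
    intro s hs hs'
    apply hcon
    exact ⟨⟨s, hs'⟩, (Submodule.mem_annihilator_span_singleton _ _).1 hs⟩
  have hfin := associatedPrimes.finite R R
  obtain ⟨p, hp, hle⟩ := (Ideal.subset_union_prime_finite hfin (f := id) 0 0
    (fun p hp _ _ => IsAssociatedPrime.isPrime hp)).1 hsub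
  have hpp : p.IsPrime := IsAssociatedPrime.isPrime hp
  have hfree := hass p hpp hp
  have hfl : Module.Flat R (LocalizedModule p.primeCompl M) :=
    Module.Flat.trans R (Localization.AtPrime p) _
  let l := LocalizedModule.mkLinearMap p.primeCompl M
  have h1 : f.lTensor (LocalizedModule p.primeCompl M) (l.rTensor A x) = 0 := by
    rw [← LinearMap.comp_apply, LinearMap.lTensor_comp_rTensor, ← LinearMap.rTensor_comp_lTensor,
      LinearMap.comp_apply, hx, map_zero]
  have h2 : l.rTensor A x = 0 := 
    Module.Flat.lTensor_preserves_injective_linearMap (M := LocalizedModule p.primeCompl M) f hf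
      (by rw [h1, map_zero])
  have : IsLocalizedModule p.primeCompl (l.rTensor A) := 
    IsLocalizedModule.rTensor (R := R) (A := R) p.primeCompl l
  obtain ⟨s, hs⟩ := (IsLocalizedModule.eq_zero_iff p.primeCompl (l.rTensor A)).1 h2
  exact s.2 (hle ((Submodule.mem_annihilator_span_singleton _ _).2 hs))
end

section
variable {R : Type} [CommRing R]

/-- `M ⊗ A* → Hom(A, M)` -/
noncomputable def tdh (M A : Type) [AddCommGroup M] [Module R M] [AddCommGroup A] [Module R A] :
    M ⊗[R] Module.Dual R A →ₗ[R] (A →ₗ[R] M) :=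
  dualTensorHom R A M ∘ₗ (TensorProduct.comm R M (Module.Dual R A)).toLinearMap

lemma tdh_tmul {M A : Type} [AddCommGroup M] [Module R M] [AddCommGroup A] [Module R A]
    (m : M) (f : Module.Dual R A) (a : A) : tdh M A (m ⊗ₜ f) a = f a • m := by
  simp [tdh]

lemma tdh_bij (M A : Type) [AddCommGroup M] [Module R M] [AddCommGroup A] [Module R A]
    [Module.Free R A] [Module.Finite R A] :
    Function.Bijective (tdh (R := R) M A) := by
  have h := (dualTensorHomEquiv R A M).bijective.comp
    (TensorProduct.comm R M (Module.Dual R A)).bijective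
  exact h

lemma tdh_nat {M A B : Type} [AddCommGroup M] [Module R M] [AddCommGroup A] [Module R A]
    [AddCommGroup B] [Module R B] (h : A →ₗ[R] B) (v : M ⊗[R] Module.Dual R B) :
    tdh M A (h.dualMap.lTensor M v) = tdh M B v ∘ₗ h := by
  induction v with
  | zero => simp
  | add x y hx hy => simp only [map_add, hx, hy, LinearMap.add_comp]
  | tmul m f => ext a; simp [tdh_tmul]

lemma tdh_nat' {M A B : Type} [AddCommGroup M] [Module R M] [AddCommGroup A] [Module R A]
    [AddCommGroup B] [Module R B] (h : B →ₗ[R] M) (v : B ⊗[R] Module.Dual R A) :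
    tdh M A (h.rTensor _ v) = h ∘ₗ tdh B A v := by
  induction v with
  | zero => simp
  | add x y hx hy => simp only [map_add, hx, hy, LinearMap.comp_add]
  | tmul m f => ext a; simp [tdh_tmul]

/-- if the Tor obstruction vanishes then the cover `g` splits. -/
lemma split_of_exact {M F₀ F₁ Q : Type} [AddCommGroup M] [Module R M]
    [AddCommGroup F₀] [Module R F₀] [AddCommGroup F₁] [Module R F₁] [AddCommGroup Q] [Module R Q]
    [Module.Free R F₀] [Module.Finite R F₀] [Module.Free R F₁] [Module.Finite R F₁]
    (d : F₁ →ₗ[R] F₀) (g : F₀ →ₗ[R] M) (hg : Function.Surjective g) (hdg : g ∘ₗ d = 0)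
    (ε : Q →ₗ[R] Module.Dual R M)
    (hex : Function.Exact ((g.dualMap ∘ₗ ε).lTensor M) (d.dualMap.lTensor M)) :
    ∃ s : M →ₗ[R] F₀, g ∘ₗ s = LinearMap.id := by
  obtain ⟨t, ht⟩ := (tdh_bij M F₀).2 g
  have h1 : d.dualMap.lTensor M t = 0 := by
    apply (tdh_bij M F₁).1
    rw [tdh_nat, ht, hdg, map_zero]
  obtain ⟨u, hu⟩ := (hex t).1 h1
  rw [LinearMap.lTensor_comp, LinearMap.comp_apply] at hu
  obtain ⟨w, hw⟩ := LinearMap.rTensor_surjective (Module.Dual R M) hg (ε.lTensor M u)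
  refine ⟨tdh F₀ M w, ?_⟩
  rw [← tdh_nat', hw]
  rw [← hu, tdh_nat] at ht
  ext x
  obtain ⟨y, rfl⟩ := hg x
  exact LinearMap.congr_fun ht y

lemma ker_eq_bot_of_split [IsLocalRing R] {M F : Type} [AddCommGroup M] [Module R M]
    [AddCommGroup F] [Module R F] [Module.Finite R F] (g : F →ₗ[R] M) (s : M →ₗ[R] F)
    (h : g ∘ₗ s = LinearMap.id)
    (hmin : LinearMap.ker g ≤ (maximalIdeal R) • (⊤ : Submodule R F)) : LinearMap.ker g = ⊥ := by
  let π : F →ₗ[R] F := LinearMap.id - s ∘ₗ g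
  have hπ : Submodule.map π ⊤ = LinearMap.ker g := by
    ext y
    constructor
    · rintro ⟨x, -, rfl⟩
      have := LinearMap.congr_fun h (g x)
      simp only [LinearMap.comp_apply, LinearMap.id_apply] at this
      simp [π, this]
    · intro hy
      rw [LinearMap.mem_ker] at hy
      exact ⟨y, trivial, by simp [π, hy]⟩
  have hfg : (LinearMap.ker g).FG := hπ ▸ (Module.Finite.fg_top.map π)
  apply Submodule.eq_bot_of_le_smul_of_le_jacobson_bot (maximalIdeal R) _ hfg
  · rw [← hπ, ← Submodule.map_smul'']
    rw [hπ]
    intro y hy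
    have hy' := LinearMap.mem_ker.1 hy
    exact ⟨y, hmin hy, by simp [π, hy']⟩
  · exact IsLocalRing.maximalIdeal_le_jacobson _

lemma exact_equiv {M M' A B C : Type} [AddCommGroup M] [Module R M] [AddCommGroup M'] [Module R M']
    [AddCommGroup A] [Module R A] [AddCommGroup B] [Module R B] [AddCommGroup C] [Module R C]
    (e : M ≃ₗ[R] M') (a : A →ₗ[R] B) (b : B →ₗ[R] C)
    (h : Function.Exact (a.lTensor M') (b.lTensor M')) :
    Function.Exact (a.lTensor M) (b.lTensor M) := by
  refine (Function.Exact.iff_of_ladder_linearEquiv (e₁ := e.rTensor A) (e₂ := e.rTensor B)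
    (e₃ := e.rTensor C) ?_ ?_).1 h <;>
  · ext
    simp

end

/-- prepend a module to a sequence -/
noncomputable def consX {R : Type} [CommRing R] (A : ModuleCat.{0} R) (X : ℕ → ModuleCat.{0} R) :
    ℕ → ModuleCat.{0} R
  | 0 => A
  | n + 1 => X n

/-- prepend a map to a sequence -/
noncomputable def consD {R : Type} [CommRing R] (A : ModuleCat.{0} R) (X : ℕ → ModuleCat.{0} R)
    (f : X 0 →ₗ[R] A) (d : ∀ i, X (i+1) →ₗ[R] X i) :
    ∀ i, consX A X (i+1) →ₗ[R] consX A X i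
  | 0 => f
  | n + 1 => d n

lemma iter_shift {R : Type} [CommRing R] {M : Type} [AddCommGroup M] [Module R M]
    (n : ℕ → ℕ) (d : ∀ i : ℕ, ((Fin (n (i + 1)) → R) →ₗ[R] (Fin (n i) → R)))
    (g : (Fin (n 0) → R) →ₗ[R] M) (hg : Function.Surjective g)
    (h0 : LinearMap.ker g = LinearMap.range (d 0))
    (hd : ∀ i, LinearMap.ker (d i) = LinearMap.range (d (i + 1)))
    (Z : ℕ → ModuleCat.{0} R) (z : ∀ i, Z (i+1) →ₗ[R] Z i)
    (hz : ∀ i, Function.Exact (z (i+1)) (z i)) (hp : ∀ i, Module.Projective R (Z i)) (k : ℕ) :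
    ∀ j, Function.Exact ((z (j+k+2)).lTensor M) ((z (j+k+1)).lTensor M) →
      Function.Exact ((z (j+1)).lTensor (LinearMap.range (d k)))
        ((z j).lTensor (LinearMap.range (d k))) := by
  have hfl : ∀ i, Module.Flat R (Z i) := fun i => inferInstance
  induction k with
  | zero =>
    intro j h
    refine shift_chase _ _ M (LinearMap.range (d 0)).subtype g hg ?_ Subtype.val_injective
      _ _ _ _ (z (j+2)) (z (j+1)) (z j) (hz _) (hz _) h
    rw [LinearMap.exact_iff, h0, Submodule.range_subtype]
  | succ k ih =>
    intro j h
    have e : j + (k + 1) = (j + 1) + k := by omega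
    rw [e] at h
    refine shift_chase _ _ (LinearMap.range (d k)) (LinearMap.range (d (k+1))).subtype
      (d k).rangeRestrict (d k).surjective_rangeRestrict ?_ Subtype.val_injective
      _ _ _ _ (z (j+2)) (z (j+1)) (z j) (hz _) (hz _) (ih (j+1) h)
    rw [LinearMap.exact_iff, LinearMap.ker_rangeRestrict, hd, Submodule.range_subtype]

end

theorem torsion_in_tensor_with_dual_of_periodic_rigid
    (R : Type) [CommRing R] [IsNoetherianRing R] [IsLocalRing R]
    (M : Type) [AddCommGroup M] [Module R M] [Module.Finite R M]
    (hM : Nontrivial M)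
    (hass : ∀ (p : Ideal R) (_ : p.IsPrime), p ∈ associatedPrimes R R →
      Module.Free (Localization.AtPrime p) (LocalizedModule p.primeCompl M))
    (q : ℕ) (hq2 : 2 ≤ q) (hqe : Even q) (hper : IsPeriodicSyzygy R M q)
    (hrig : ∀ (N : Type) [AddCommGroup N] [Module R N] [Module.Finite R N] (r : ℕ), 1 ≤ r →
      Subsingleton (TorM R r M N) → ∀ j : ℕ, r ≤ j → Subsingleton (TorM R j M N)) :
    Submodule.torsion R (TensorProduct R M (Module.Dual R M)) ≠ ⊥ := by
  intro ht
  obtain ⟨n, d, g, hg, h0, hd, hmin0, hmin, ⟨e⟩⟩ := hper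
  obtain ⟨X, δ, ε, hXp, hε, hδ0, hδ⟩ := exists_res (R := R) (Module.Dual R M)
  have hgd : Function.Injective g.dualMap := LinearMap.dualMap_injective_of_surjective hg
  have hgdc : g ∘ₗ d 0 = 0 := by
    refine LinearMap.ext fun x => ?_
    have hx : d 0 x ∈ LinearMap.ker g := by
      rw [h0]
      exact LinearMap.mem_range_self (d 0) x
    exact LinearMap.mem_ker.1 hx
  have hex0 : Function.Exact (g.dualMap ∘ₗ ε) (d 0).dualMap := by
    intro f
    constructor
    · intro hf
      have hf' : f ∘ₗ d 0 = 0 := hf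
      have hker : LinearMap.ker g ≤ LinearMap.ker f := by
        rw [h0]
        rintro _ ⟨x, rfl⟩
        exact LinearMap.congr_fun hf' x
      have hr : f ∈ LinearMap.range g.dualMap := by
        rw [LinearMap.range_dualMap_eq_dualAnnihilator_ker_of_surjective g hg]
        rw [Submodule.mem_dualAnnihilator]
        exact fun w hw => hker hw
      obtain ⟨f', hf'⟩ := hr
      obtain ⟨w, rfl⟩ := hε f'
      exact ⟨w, hf'⟩
    · rintro ⟨w, rfl⟩
      show (ε w ∘ₗ g) ∘ₗ d 0 = 0
      rw [LinearMap.comp_assoc, hgdc, LinearMap.comp_zero]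
  have hinj := inj_of_torsionFree M _ _ hass g.dualMap hgd ht
  have hex1 : Function.Exact ((δ 0).lTensor M) ((g.dualMap ∘ₗ ε).lTensor M) := by
    intro x
    rw [LinearMap.lTensor_comp, LinearMap.comp_apply, map_eq_zero_iff _ hinj]
    exact lTensor_exact M hδ0 hε x
  -- the resolution of `C`
  let Y := consX (ModuleCat.of R (Module.Dual R (Fin (n 0) → R))) X
  let y : ∀ i, Y (i+1) →ₗ[R] Y i := consD _ X (g.dualMap ∘ₗ ε) δ
  have hy : ∀ i, Function.Exact (y (i+1)) (y i) := by
    rintro (_ | i)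
    · intro x
      exact (map_eq_zero_iff g.dualMap hgd (x := ε x)).trans (hδ0 x)
    · exact hδ i
  have hYp : ∀ i, Module.Projective R (Y i) := by
    rintro (_ | i)
    · exact inferInstanceAs (Module.Projective R (Module.Dual R (Fin (n 0) → R)))
    · exact hXp i
  let Z := consX (ModuleCat.of R (Module.Dual R (Fin (n 1) → R))) Y
  let z : ∀ i, Z (i+1) →ₗ[R] Z i := consD _ Y (d 0).dualMap y
  have hz : ∀ i, Function.Exact (z (i+1)) (z i) := by
    rintro (_ | i)
    · exact hex0
    · exact hy i
  have hZp : ∀ i, Module.Projective R (Z i) := by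
    rintro (_ | i)
    · exact inferInstanceAs (Module.Projective R (Module.Dual R (Fin (n 1) → R)))
    · exact hYp i
  let C := Module.Dual R (Fin (n 0) → R) ⧸ LinearMap.range (g.dualMap ∘ₗ ε)
  let ε' : Module.Dual R (Fin (n 0) → R) →ₗ[R] C := (LinearMap.range (g.dualMap ∘ₗ ε)).mkQ
  have hε' : Function.Surjective ε' := Submodule.mkQ_surjective _
  have hε0 : Function.Exact (g.dualMap ∘ₗ ε) ε' := LinearMap.exact_map_mkQ_range _
  have htor := tor_iff Y y hy hYp M C ε' hε' hε0
  have hT1 : Subsingleton (TorM R (0+1) M C) := (htor 0).2 hex1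
  have hTj := hrig C 1 le_rfl hT1
  obtain ⟨k, rfl⟩ : ∃ k, q = k + 1 := ⟨q - 1, by omega⟩
  have hE : Function.Exact ((z (0+k+2)).lTensor M) ((z (0+k+1)).lTensor M) := by
    have := (htor (0+k)).1 (hTj (0+k+1) (by omega))
    exact this
  have hE0 := iter_shift n d g hg h0 hd Z z hz hZp k 0 hE
  have hEM := exact_equiv (M := M) e (z 1) (z 0) hE0
  obtain ⟨s, hs⟩ := split_of_exact (d 0) g hg hgdc ε hEM
  have hk0 := ker_eq_bot_of_split g s hs hmin0
  have hall : ∀ i, LinearMap.range (d i) = ⊥ := by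
    intro i
    induction i with
    | zero => rw [← h0, hk0]
    | succ i ih =>
      have htop : (⊤ : Submodule R (Fin (n (i+1)) → R)) = ⊥ := by
        apply Submodule.eq_bot_of_le_smul_of_le_jacobson_bot (maximalIdeal R) _
          Module.Finite.fg_top
        · rw [LinearMap.range_eq_bot] at ih
          refine le_trans ?_ (hmin (i+1))
          rw [← hd i, ih, LinearMap.ker_zero]
        · exact IsLocalRing.maximalIdeal_le_jacobson _
      exact le_bot_iff.1 (htop ▸ le_top)
  have hfin : Subsingleton (LinearMap.range (d (k + 1 - 1))) := by
    rw [hall]; infer_instance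
  exact not_subsingleton M (e.toEquiv.subsingleton)
end

section
/- Let R be a one-dimensional commutative Noetherian local domain and M a nonzero finitely generated R-module with M ≅ Ω²M. Then M ⊗_R Hom_R(M,R) has nonzero torsion submodule. -/
open CategoryTheory IsLocalRing

open scoped TensorProduct

/-- A finite module over a domain has a free submodule with bounded torsion quotient. -/
theorem aux_exists_free (R : Type) [CommRing R] [IsDomain R]
    (N : Type) [AddCommGroup N] [Module R N] [Module.Finite R N] :
    ∃ (L : Submodule R N), Module.Free R L ∧ ∃ c : R, c ≠ 0 ∧ ∀ x : N, c • x ∈ L := by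
  obtain ⟨f, hf⟩ := exists_linearIndependent_of_le_finrank (R := R) (M := N) le_rfl
  refine ⟨Submodule.span R (Set.range f), Module.Free.of_basis (Module.Basis.span hf), ?_⟩
  have h0 : Module.finrank R (N ⧸ Submodule.span R (Set.range f)) = 0 := by
    have h1 := Submodule.finrank_quotient_add_finrank (Submodule.span R (Set.range f))
    have h2 := finrank_span_eq_card hf
    simp only [Fintype.card_fin] at h2
    omega
  rw [Module.finrank_eq_zero_iff_isTorsion] at h0
  obtain ⟨c, hc, hc0⟩ := Submodule.annihilator_top_inter_nonZeroDivisors h0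
  refine ⟨c, nonZeroDivisors.ne_zero hc0, fun x => ?_⟩
  have := (Submodule.mem_annihilator.mp hc) (Submodule.Quotient.mk x) Submodule.mem_top
  rwa [← Submodule.Quotient.mk_smul, Submodule.Quotient.mk_eq_zero] at this

/-- A finite module killed by a nonzero element over a one-dimensional domain is Artinian. -/
theorem aux_artinian (R : Type) [CommRing R] [IsDomain R] [IsNoetherianRing R]
    (hdim : ringKrullDim R = 1)
    (T : Type) [AddCommGroup T] [Module R T] [Module.Finite R T] (c : R) (hc : c ≠ 0)
    (h : ∀ x : T, c • x = 0) : IsArtinian R T := by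
  have : Ring.KrullDimLE 1 R := by
    rw [Ring.KrullDimLE, Order.krullDimLE_iff]
    exact hdim.le
  have h1 := isFiniteLength_quotient_span_singleton R (mem_nonZeroDivisors_of_ne_zero hc)
  rw [isFiniteLength_iff_isNoetherian_isArtinian] at h1
  have := h1.2
  obtain ⟨n, s, hs⟩ := Module.Finite.exists_fin (R := R) (M := T)
  let φ : (Fin n → (R ⧸ Ideal.span {c})) →ₗ[R] T :=
    LinearMap.lsum R (fun _ => R ⧸ Ideal.span {c}) R fun i =>
      Submodule.liftQ (Ideal.span {c}) (LinearMap.toSpanSingleton R T (s i)) (by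
        rw [Ideal.span, Submodule.span_le]
        rintro x rfl
        simp [h])
  refine isArtinian_of_surjective _ φ ?_
  rw [← LinearMap.range_eq_top, eq_top_iff, ← hs, Submodule.span_le]
  rintro _ ⟨i, rfl⟩
  refine ⟨Pi.single i (Submodule.Quotient.mk 1), ?_⟩
  simp only [φ]
  rw [LinearMap.lsum_piSingle]
  exact (Submodule.liftQ_apply _ _ _).trans (one_smul R (s i))

/-- Herbrand quotient argument for modules of finite length. -/
theorem aux_herbrand (R : Type) [CommRing R]
    (X Y : Type) [AddCommGroup X] [Module R X] [AddCommGroup Y] [Module R Y]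
    [IsArtinian R X] [IsNoetherian R X] (hXY : Module.length R X = Module.length R Y)
    (a : X →ₗ[R] Y) (b : Y →ₗ[R] X) (hab : a ∘ₗ b = 0)
    (h : Function.Exact a b) : Function.Exact b a := by
  have ha := Module.length_eq_add_of_exact (LinearMap.ker a).subtype a.rangeRestrict
    (Submodule.subtype_injective _) a.surjective_rangeRestrict
    (by intro x; rw [← Submodule.coe_eq_zero]; simp)
  have hb := Module.length_eq_add_of_exact (LinearMap.ker b).subtype b.rangeRestrict
    (Submodule.subtype_injective _) b.surjective_rangeRestrict
    (by intro x; rw [← Submodule.coe_eq_zero]; simp)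
  rw [LinearMap.exact_iff] at h
  rw [h, ← hXY, ha, add_comm] at hb
  have hfin : Module.length R (LinearMap.range a) ≠ ⊤ := by
    intro h'
    apply Module.length_ne_top (R := R) (M := X)
    rw [ha, h', add_top]
  have hlen : Module.length R (LinearMap.ker a) = Module.length R (LinearMap.range b) := by
    exact WithTop.add_left_cancel hfin hb
  have hle : LinearMap.range b ≤ LinearMap.ker a := by
    rw [LinearMap.range_le_ker_iff]; exact hab
  rw [LinearMap.exact_iff]
  refine le_antisymm ?_ hle
  by_contra hn
  have hlt : LinearMap.range b < LinearMap.ker a := lt_of_le_not_ge hle hn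
  have := Submodule.height_strictMono hlt
  rw [← Module.length_submodule, ← Module.length_submodule, hlen] at this
  exact lt_irrefl _ this

/-- The theta invariant vanishes: exactness in one spot gives exactness in the other. -/
theorem aux_theta (R : Type) [CommRing R] [IsDomain R] [IsNoetherianRing R]
    (hdim : ringKrullDim R = 1)
    (N : Type) [AddCommGroup N] [Module R N] [Module.Finite R N]
    (n m : ℕ) (hnm : n = m) (a : (Fin n → R) →ₗ[R] (Fin m → R))
    (b : (Fin m → R) →ₗ[R] (Fin n → R))
    (hab : Function.Exact a b) (hba : Function.Exact b a)
    (h : Function.Exact (a.lTensor N) (b.lTensor N)) :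
    Function.Exact (b.lTensor N) (a.lTensor N) := by
  obtain ⟨L, hL, c, hc, hcL⟩ := aux_exists_free R N
  have hLab : Function.Exact (a.lTensor L) (b.lTensor L) := Module.Flat.lTensor_exact L hab
  have hLba : Function.Exact (b.lTensor L) (a.lTensor L) := Module.Flat.lTensor_exact L hba
  have hTart : IsArtinian R (N ⧸ L) := aux_artinian R hdim _ c hc (by
    intro x
    obtain ⟨x, rfl⟩ := Submodule.mkQ_surjective L x
    rw [← map_smul]
    exact (Submodule.Quotient.mk_eq_zero L).mpr (hcL x))
  have comm (P Q : Type) [AddCommGroup P] [Module R P] [AddCommGroup Q] [Module R Q]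
      (f : P →ₗ[R] Q) (k l : ℕ) (t : (Fin k → R) →ₗ[R] (Fin l → R)) (x) :
      t.lTensor Q (f.rTensor _ x) = f.rTensor _ (t.lTensor P x) := by
    rw [← LinearMap.comp_apply, ← LinearMap.comp_apply, LinearMap.lTensor_comp_rTensor,
      LinearMap.rTensor_comp_lTensor]
  have hex (k : ℕ) : Function.Exact (L.subtype.rTensor (Fin k → R)) (L.mkQ.rTensor (Fin k → R)) :=
    rTensor_exact _ (LinearMap.exact_subtype_mkQ L) (Submodule.mkQ_surjective L)
  have hsurj (k : ℕ) : Function.Surjective (L.mkQ.rTensor (Fin k → R)) :=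
    LinearMap.rTensor_surjective _ (Submodule.mkQ_surjective L)
  have hinj (k : ℕ) : Function.Injective (L.subtype.rTensor (Fin k → R)) :=
    Module.Flat.rTensor_preserves_injective_linearMap _ (Submodule.subtype_injective L)
  have hcab : b ∘ₗ a = 0 := hab.linearMap_comp_eq_zero
  have hcba : a ∘ₗ b = 0 := hba.linearMap_comp_eq_zero
  have zab (P : Type) [AddCommGroup P] [Module R P] (x) : b.lTensor P (a.lTensor P x) = 0 := by
    rw [← LinearMap.comp_apply, ← LinearMap.lTensor_comp, hcab]; simp
  have zba (P : Type) [AddCommGroup P] [Module R P] (x) : a.lTensor P (b.lTensor P x) = 0 := by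
    rw [← LinearMap.comp_apply, ← LinearMap.lTensor_comp, hcba]; simp
  have hT : Function.Exact (a.lTensor (N ⧸ L)) (b.lTensor (N ⧸ L)) := by
    intro t
    constructor
    · intro ht
      obtain ⟨x, rfl⟩ := hsurj _ t
      rw [comm] at ht
      obtain ⟨l, hl⟩ := (hex _ _).mp ht
      have h1 : a.lTensor L l = 0 := by
        apply hinj
        rw [← comm, hl, zba, map_zero]
      obtain ⟨l', rfl⟩ := (hLba _).mp h1
      have h2 : b.lTensor N (x - L.subtype.rTensor _ l') = 0 := by
        rw [map_sub, comm, hl, sub_self]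
      obtain ⟨y, hy⟩ := (h _).mp h2
      refine ⟨L.mkQ.rTensor _ y, ?_⟩
      rw [comm, hy, map_sub, (hex _).apply_apply_eq_zero, sub_zero]
    · rintro ⟨y, rfl⟩
      exact zab _ _
  have e (k : ℕ) : (N ⧸ L) ⊗[R] (Fin k → R) ≃ₗ[R] (Fin k → (N ⧸ L)) :=
    TensorProduct.piScalarRight R R (N ⧸ L) (Fin k)
  have : IsArtinian R ((N ⧸ L) ⊗[R] (Fin n → R)) := isArtinian_of_linearEquiv (e n).symm
  have : IsNoetherian R ((N ⧸ L) ⊗[R] (Fin n → R)) := isNoetherian_of_linearEquiv (e n).symm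
  have hT' : Function.Exact (b.lTensor (N ⧸ L)) (a.lTensor (N ⧸ L)) := by
    refine aux_herbrand R _ _ ?_ _ _ ?_ hT
    · rw [(e n).length_eq, (e m).length_eq, hnm]
    · exact LinearMap.ext fun x => zba _ x
  intro x
  constructor
  · intro hx
    have h1 : a.lTensor (N ⧸ L) (L.mkQ.rTensor _ x) = 0 := by rw [comm, hx, map_zero]
    obtain ⟨y, hy⟩ := (hT' _).mp h1
    obtain ⟨y, rfl⟩ := hsurj _ y
    have h2 : L.mkQ.rTensor _ (x - b.lTensor N y) = 0 := by
      rw [map_sub, ← comm, hy, sub_self]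
    obtain ⟨l, hl⟩ := (hex _ _).mp h2
    have h3 : a.lTensor L l = 0 := by
      apply hinj
      rw [← comm, hl, map_sub, hx, zba, sub_zero, map_zero]
    obtain ⟨l', rfl⟩ := (hLba _).mp h3
    refine ⟨y + L.subtype.rTensor _ l', ?_⟩
    rw [map_add, comm, hl]; abel
  · rintro ⟨y, rfl⟩
    exact zba _ _

/-- If `N ⊗ M` is torsion-free then tensoring an injection out of `M` by `N` stays injective. -/
theorem aux_inj (R : Type) [CommRing R] [IsDomain R]
    (N M F : Type) [AddCommGroup N] [Module R N] [Module.Finite R N]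
    [AddCommGroup M] [Module R M] [AddCommGroup F] [Module R F]
    (ι : M →ₗ[R] F) (hι : Function.Injective ι)
    (htf : ∀ (c : R) (z : N ⊗[R] M), c ≠ 0 → c • z = 0 → z = 0) :
    Function.Injective (ι.lTensor N) := by
  obtain ⟨L, hL, c, hc, hcL⟩ := aux_exists_free R N
  let q : N →ₗ[R] L := LinearMap.codRestrict L (LinearMap.lsmul R N c) hcL
  have hq : L.subtype ∘ₗ q = c • LinearMap.id := LinearMap.ext fun _ => rfl
  rw [injective_iff_map_eq_zero]
  intro z hz
  apply htf c z hc
  have h1 : q.rTensor M z = 0 := by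
    apply Module.Flat.lTensor_preserves_injective_linearMap (M := L) ι hι
    rw [map_zero, ← LinearMap.comp_apply, LinearMap.lTensor_comp_rTensor,
      ← LinearMap.rTensor_comp_lTensor, LinearMap.comp_apply, hz, map_zero]
  have h2 : (L.subtype ∘ₗ q).rTensor M z = 0 := by
    rw [LinearMap.rTensor_comp, LinearMap.comp_apply, h1, map_zero]
  rw [hq, LinearMap.rTensor_smul, LinearMap.rTensor_id] at h2
  simpa using h2

/-- `M* ⊗ R^k → Hom(M, R^k)` is bijective. -/
theorem aux_hom (R : Type) [CommRing R] (M : Type) [AddCommGroup M] [Module R M] (k : ℕ) :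
    Function.Bijective (dualTensorHom R M (Fin k → R)) := by
  have key : ∀ (w : Module.Dual R M ⊗[R] (Fin k → R)) (x : M) (i : Fin k),
      dualTensorHom R M (Fin k → R) w x i =
        TensorProduct.piScalarRight R R (Module.Dual R M) (Fin k) w i x := by
    intro w x i
    induction w with
    | zero => simp
    | tmul f v => simp [mul_comm]
    | add u v hu hv => simp [hu, hv]
  constructor
  · intro u v huv
    apply (TensorProduct.piScalarRight R R (Module.Dual R M) (Fin k)).injective
    ext i x
    rw [← key, ← key, huv]
  · intro f
    refine ⟨(TensorProduct.piScalarRight R R (Module.Dual R M) (Fin k)).symm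
      (fun i => LinearMap.proj i ∘ₗ f), ?_⟩
    ext x i
    rw [key]
    simp

theorem torsion_in_tensor_with_dual_two_periodic_one_dim_domain
    (R : Type) [CommRing R] [IsNoetherianRing R] [IsLocalRing R] [IsDomain R]
    (hdim : ringKrullDim R = 1)
    (M : Type) [AddCommGroup M] [Module R M] [Module.Finite R M]
    (hM : Nontrivial M) (hper : IsPeriodicSyzygy R M 2) :
    Submodule.torsion R (TensorProduct R M (Module.Dual R M)) ≠ ⊥ := by
  intro htors
  obtain ⟨n, d, g, hg, hkg, hd, hmg, hmd, ⟨e⟩⟩ := hper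
  simp only [Nat.add_one_sub_one] at e
  change M ≃ₗ[R] LinearMap.range (d 1) at e
  let ι : M →ₗ[R] (Fin (n 1) → R) := (LinearMap.range (d 1)).subtype ∘ₗ e.toLinearMap
  have hι : Function.Injective ι := by
    simpa [ι] using e.injective
  have hrι : LinearMap.range ι = LinearMap.ker (d 0) := by
    rw [hd 0]
    simp [ι, LinearMap.range_comp]
  -- equality of ranks
  have hn : n 1 = n 0 := by
    have h1 := Submodule.finrank_quotient_add_finrank (LinearMap.ker (d 0))
    have h2 := Submodule.finrank_quotient_add_finrank (LinearMap.ker g)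
    rw [(d 0).quotKerEquivRange.finrank_eq, ← hrι,
      ← (LinearEquiv.ofInjective ι hι).finrank_eq, ← hkg] at h1
    rw [(g.quotKerEquivOfSurjective hg).finrank_eq] at h2
    rw [Module.finrank_fin_fun] at h1 h2
    change _ = n 1 at h1
    rw [add_comm] at h1
    exact h1.symm.trans h2
  have hga : Function.Exact (d 0) g := LinearMap.exact_iff.mpr hkg
  have hab : Function.Exact (d 0) (ι ∘ₗ g) := by
    rw [LinearMap.exact_iff, LinearMap.ker_comp_of_ker_eq_bot _ (LinearMap.ker_eq_bot.mpr hι), hkg]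
  have hba : Function.Exact (ι ∘ₗ g) (d 0) := by
    rw [LinearMap.exact_iff, LinearMap.range_comp_of_range_eq_top _ (LinearMap.range_eq_top.mpr hg),
      hrι]
  have htf : ∀ (c : R) (z : Module.Dual R M ⊗[R] M), c ≠ 0 → c • z = 0 → z = 0 := by
    intro c z hc hz
    apply (TensorProduct.comm R (Module.Dual R M) M).injective
    rw [map_zero, ← Submodule.mem_bot R, ← htors, Submodule.mem_torsion_iff]
    refine ⟨⟨c, mem_nonZeroDivisors_of_ne_zero hc⟩, ?_⟩
    rw [Submonoid.mk_smul, ← map_smul, hz, map_zero]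
  have hinj := aux_inj R (Module.Dual R M) M _ ι hι htf
  have hNab : Function.Exact ((d 0).lTensor (Module.Dual R M))
      ((ι ∘ₗ g).lTensor (Module.Dual R M)) := by
    intro y
    rw [LinearMap.lTensor_comp, LinearMap.comp_apply]
    exact (map_eq_zero_iff _ hinj).trans (lTensor_exact _ hga hg y)
  have hNba := aux_theta R hdim (Module.Dual R M) _ _ hn _ _ hab hba hNab
  obtain ⟨z, hz⟩ := (aux_hom R M (n 1)).2 ι
  have nat (k l : ℕ) (t : (Fin k → R) →ₗ[R] (Fin l → R)) (w) :
      dualTensorHom R M (Fin l → R) (t.lTensor _ w) = t ∘ₗ dualTensorHom R M (Fin k → R) w := by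
    induction w with
    | zero => simp
    | tmul f v => ext; simp
    | add u v hu hv => simp [hu, hv, LinearMap.comp_add]
  have hz0 : (d 0).lTensor (Module.Dual R M) z = 0 := by
    apply (aux_hom R M (n 0)).1
    rw [nat, hz, map_zero, ← LinearMap.range_le_ker_iff, hrι]
  obtain ⟨w, hw⟩ := (hNba z).mp hz0
  let ψ := dualTensorHom R M (Fin (n 0) → R) w
  have hψ : ∀ x, g (ψ x) = x := by
    intro x
    apply hι
    have := nat _ _ (ι ∘ₗ g) w
    rw [hw, hz] at this
    exact (LinearMap.congr_fun this x).symm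
  have hjac : maximalIdeal R ≤ Ideal.jacobson ⊥ := (IsLocalRing.jacobson_eq_maximalIdeal ⊥ bot_ne_top).ge
  have hψs : (⊤ : Submodule R (Fin (n 0) → R)) ≤ LinearMap.range ψ := by
    refine Submodule.le_of_le_smul_of_le_jacobson_bot Module.Finite.fg_top hjac ?_
    intro x _
    have h1 : x = ψ (g x) + (x - ψ (g x)) := by abel
    rw [h1]
    refine Submodule.add_mem_sup ⟨_, rfl⟩ (hmg ?_)
    rw [LinearMap.mem_ker, map_sub, hψ, sub_self]
  have hker : LinearMap.ker g = ⊥ := by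
    rw [eq_bot_iff]
    intro x hx
    obtain ⟨y, rfl⟩ := hψs (Submodule.mem_top (x := x))
    rw [LinearMap.mem_ker, hψ] at hx
    simp [hx]
  have htop : LinearMap.range (d 1) = ⊤ := by
    rw [← hd 0, LinearMap.ker_eq_top, ← LinearMap.range_eq_bot, ← hkg, hker]
  have hbot : (⊤ : Submodule R (Fin (n 1) → R)) ≤ ⊥ := by
    refine Submodule.le_of_le_smul_of_le_jacobson_bot Module.Finite.fg_top hjac ?_
    rw [bot_sup_eq]
    exact htop.ge.trans (hmd 1)
  obtain ⟨x, hx⟩ := exists_ne (0 : M)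
  apply hx
  apply hι
  rw [map_zero]
  exact hbot Submodule.mem_top
end

section
/- Let R be a commutative Noetherian local ring, M a finitely generated R-module locally free on the punctured spectrum with M ≅ Ω²M, and x ∈ m a non-zerodivisor on R. Then for every torsion-free finitely generated R-module N, the pair (M/xM, N/xN) is Tor-rigid over R/xR. -/
open CategoryTheory IsLocalRing

section TorHelpers

open TensorProduct


/-- Diagram chase for a short exact sequence tensored with a resolution. -/
theorem chase_iff {S : Type} [CommRing S] {A' F A Q3 Q2 Q1 Q0 : Type}
    [AddCommGroup A'] [AddCommGroup F] [AddCommGroup A]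
    [AddCommGroup Q3] [AddCommGroup Q2] [AddCommGroup Q1] [AddCommGroup Q0]
    [Module S A'] [Module S F] [Module S A]
    [Module S Q3] [Module S Q2] [Module S Q1] [Module S Q0]
    [Module.Flat S F] [Module.Flat S Q1]
    (f : A' →ₗ[S] F) (g : F →ₗ[S] A) (hf : Function.Injective f) (hg : Function.Surjective g)
    (hfg : Function.Exact f g)
    (a : Q3 →ₗ[S] Q2) (b : Q2 →ₗ[S] Q1) (c : Q1 →ₗ[S] Q0)
    (hab : Function.Exact a b) (hbc : Function.Exact b c) :
    Function.Exact (a.lTensor A) (b.lTensor A) ↔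
      ∀ u : A' ⊗[S] Q1, f.rTensor Q0 (c.lTensor A' u) = 0 → ∃ v, b.lTensor A' v = u := by
  have cm : ∀ {B B' P P' : Type} [AddCommGroup B] [AddCommGroup B'] [AddCommGroup P]
      [AddCommGroup P'] [Module S B] [Module S B'] [Module S P] [Module S P']
      (h : B →ₗ[S] B') (k : P →ₗ[S] P') (t : B ⊗[S] P),
      h.rTensor P' (k.lTensor B t) = k.lTensor B' (h.rTensor P t) := by
    intro B B' P P' _ _ _ _ _ _ _ _ h k t
    rw [← LinearMap.comp_apply, ← LinearMap.comp_apply, LinearMap.rTensor_comp_lTensor,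
      LinearMap.lTensor_comp_rTensor]
  have Fab := Module.Flat.lTensor_exact F hab
  have Fbc := Module.Flat.lTensor_exact F hbc
  have inj1 := Module.Flat.rTensor_preserves_injective_linearMap (M := Q1) f hf
  have ex2 := rTensor_exact Q2 hfg hg
  have ex1 := rTensor_exact Q1 hfg hg
  have s2 := LinearMap.rTensor_surjective Q2 hg
  have s3 := LinearMap.rTensor_surjective Q3 hg
  have bb : ∀ {B : Type} [AddCommGroup B] [Module S B] (t : B ⊗[S] Q3),
      b.lTensor B (a.lTensor B t) = 0 := by
    intro B _ _ t
    rw [← LinearMap.comp_apply, ← LinearMap.lTensor_comp, hab.linearMap_comp_eq_zero]; simp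
  constructor
  · intro H u hu
    rw [cm] at hu
    obtain ⟨w, hw⟩ := (Fbc _).1 hu
    have h1 : b.lTensor A (g.rTensor Q2 w) = 0 := by
      rw [← cm, hw]; exact (ex1 _).2 ⟨u, rfl⟩
    obtain ⟨z, hz⟩ := (H _).1 h1
    obtain ⟨z', rfl⟩ := s3 z
    have h2 : g.rTensor Q2 (w - a.lTensor F z') = 0 := by
      rw [map_sub, cm, hz, sub_self]
    obtain ⟨v, hv⟩ := (ex2 _).1 h2
    refine ⟨v, inj1 ?_⟩
    rw [cm, hv, map_sub, bb, sub_zero, hw]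
  · intro H w
    constructor
    · intro hw
      obtain ⟨w', rfl⟩ := s2 w
      rw [← cm] at hw
      obtain ⟨u, hu⟩ := (ex1 _).1 hw
      have h1 : f.rTensor Q0 (c.lTensor A' u) = 0 := by
        rw [cm, hu]; exact (Fbc _).2 ⟨w', rfl⟩
      obtain ⟨v, rfl⟩ := H u h1
      have h2 : b.lTensor F (w' - f.rTensor Q2 v) = 0 := by
        rw [map_sub, ← hu, cm, sub_self]
      obtain ⟨z, hz⟩ := (Fab _).1 h2
      refine ⟨g.rTensor Q3 z, ?_⟩
      rw [← cm, hz, map_sub, (ex2 _).2 ⟨v, rfl⟩, sub_zero]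
    · rintro ⟨z, rfl⟩
      exact bb z

theorem exists_res_s9 (S : Type) [CommRing S] (N : Type) [AddCommGroup N] [Module S N] :
    ∃ (P : ℕ → ModuleCat.{0} S) (d : ∀ i, P (i + 1) →ₗ[S] P i) (e : P 0 →ₗ[S] N),
      (∀ i, Module.Flat S (P i)) ∧ Function.Surjective e ∧ Function.Exact (d 0) e ∧
      (∀ i, Function.Exact (d (i + 1)) (d i)) ∧
      ∀ (A : Type) [AddCommGroup A] [Module S A] (i : ℕ),
        Subsingleton (TorM S (i + 1) A N) ↔
          Function.Exact ((d (i + 1)).lTensor A) ((d i).lTensor A) := by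
  let P := ProjectiveResolution.of (ModuleCat.of S N)
  refine ⟨fun i => P.complex.X i, fun i => (P.complex.d (i + 1) i).hom,
    (P.π.f 0).hom, ?_, ?_, ?_, ?_, ?_⟩
  · intro i
    have := P.projective i
    have : Module.Projective S (P.complex.X i) := (IsProjective.iff_projective _).2 this
    infer_instance
  · exact (ModuleCat.epi_iff_surjective _).1 inferInstance
  · exact (ShortComplex.ShortExact.moduleCat_exact_iff_function_exact _).1 P.exact₀
  · intro i
    exact (ShortComplex.ShortExact.moduleCat_exact_iff_function_exact _).1 (P.exact_succ i)
  · intro A _ _ i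
    rw [← ModuleCat.isZero_iff_subsingleton]
    have e := P.isoLeftDerivedObj ((MonoidalCategory.tensoringLeft (ModuleCat S)).obj (ModuleCat.of S A)) (i + 1)
    refine (e.isZero_iff).trans ?_
    refine (HomologicalComplex.exactAt_iff_isZero_homology _ _).symm.trans ?_
    rw [HomologicalComplex.exactAt_iff' _ (i + 2) (i + 1) i (by simp) (by simp)]
    exact (ShortComplex.ShortExact.moduleCat_exact_iff_function_exact _)

theorem tor_shift {S : Type} [CommRing S] {A' F A : Type} (N : Type)
    [AddCommGroup A'] [AddCommGroup F] [AddCommGroup A] [AddCommGroup N]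
    [Module S A'] [Module S F] [Module S A] [Module S N] [Module.Flat S F]
    (f : A' →ₗ[S] F) (g : F →ₗ[S] A) (hf : Function.Injective f) (hg : Function.Surjective g)
    (hfg : Function.Exact f g) :
    (∀ i, Subsingleton (TorM S (i + 2) A N) ↔ Subsingleton (TorM S (i + 1) A' N)) ∧
    (Subsingleton (TorM S 1 A N) ↔ Function.Injective (f.rTensor N)) := by
  obtain ⟨P, d, e, hP, he, hde, hd, H⟩ := exists_res_s9 S N
  have := hP
  constructor
  · intro i
    rw [H A (i + 1), H A' i, chase_iff f g hf hg hfg (d (i + 2)) (d (i + 1)) (d i) (hd _) (hd _)]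
    have inj := Module.Flat.rTensor_preserves_injective_linearMap (M := P i) f hf
    have hz : ∀ v, (d i).lTensor A' ((d (i + 1)).lTensor A' v) = 0 := by
      intro v
      rw [← LinearMap.comp_apply, ← LinearMap.lTensor_comp, (hd i).linearMap_comp_eq_zero]; simp
    constructor
    · intro h u
      exact ⟨fun hu => h u (by rw [hu, map_zero]), fun ⟨v, hv⟩ => hv ▸ hz v⟩
    · intro h u hu
      exact (h u).1 (inj (by rw [hu, map_zero]))
  · rw [H A 0, chase_iff f g hf hg hfg (d 1) (d 0) e (hd _) hde]
    have ex := lTensor_exact A' hde he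
    rw [injective_iff_map_eq_zero]
    constructor
    · intro h t ht
      obtain ⟨u, rfl⟩ := LinearMap.lTensor_surjective A' he t
      exact (ex u).2 (h u ht)
    · intro h u hu
      exact (ex u).1 (h _ hu)

end TorHelpers

section CoreHelpers

open TensorProduct

/-- The map `f ⊗ N` is injective modulo `x`. -/
def InjMod {R : Type} [CommRing R] (x : R) {L F : Type} (N : Type)
    [AddCommGroup L] [AddCommGroup F] [AddCommGroup N] [Module R L] [Module R F] [Module R N]
    (f : L →ₗ[R] F) : Prop :=
  ∀ (t : L ⊗[R] N) (s : F ⊗[R] N), f.rTensor N t = x • s → ∃ t', t = x • t'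

theorem core {R : Type} [CommRing R] [IsNoetherianRing R] [IsLocalRing R]
    {x : R} (hx : x ∈ maximalIdeal R) {L F M G N : Type}
    [AddCommGroup L] [AddCommGroup F] [AddCommGroup M] [AddCommGroup G] [AddCommGroup N]
    [Module R L] [Module R F] [Module R M] [Module R G] [Module R N]
    [Module.Finite R L] [Module.Finite R N] [Module.Flat R F]
    (hN : ∀ n : N, x • n = 0 → n = 0)
    (f : L →ₗ[R] F) (g : F →ₗ[R] M) (hg : Function.Surjective g) (hfg : Function.Exact f g)
    (h : M →ₗ[R] G) (k : G →ₗ[R] L) (hk : Function.Surjective k) (hhk : Function.Exact h k)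
    (htor : ∀ t : M ⊗[R] N, h.rTensor N t = 0 → ∃ n : ℕ, x ^ n • t = 0)
    (H : InjMod x N f) : InjMod x N h := by
  have Fx : ∀ s : F ⊗[R] N, x • s = 0 → s = 0 := by
    intro s hs
    have inj : Function.Injective (LinearMap.lsmul R N x) :=
      (injective_iff_map_eq_zero _).2 hN
    have := Module.Flat.lTensor_preserves_injective_linearMap (M := F) _ inj
    apply (injective_iff_map_eq_zero _).1 this
    have e : (LinearMap.lsmul R N x).lTensor F = x • LinearMap.id := by
      ext; simp
    rw [e]; simpa using hs
  have K1 : ∀ t : L ⊗[R] N, f.rTensor N t = 0 → t = 0 := by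
    have : LinearMap.ker (f.rTensor N) = ⊥ := by
      apply Submodule.eq_bot_of_le_smul_of_le_jacobson_bot (maximalIdeal R) _
        (IsNoetherian.noetherian _)
      · intro t ht
        obtain ⟨t', rfl⟩ := H t 0 (by simpa using ht)
        apply Submodule.smul_mem_smul hx
        apply Fx
        simpa using ht
      · exact IsLocalRing.maximalIdeal_le_jacobson _
    intro t ht
    simpa [this] using (show t ∈ LinearMap.ker (f.rTensor N) from ht)
  have ex1 := rTensor_exact N hfg hg
  have ex2 := rTensor_exact N hhk hk
  have Mx : ∀ t : M ⊗[R] N, x • t = 0 → t = 0 := by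
    intro t ht
    obtain ⟨s, rfl⟩ := LinearMap.rTensor_surjective N hg t
    rw [← map_smul] at ht
    obtain ⟨l, hl⟩ := (ex1 _).1 ht
    obtain ⟨l', rfl⟩ := H l s hl
    rw [map_smul] at hl
    have : s = f.rTensor N l' := by
      rw [← sub_eq_zero]; apply Fx; rw [smul_sub, hl, sub_self]
    rw [this]; exact (ex1 _).2 ⟨l', rfl⟩
  have Mxn : ∀ (n : ℕ) (t : M ⊗[R] N), x ^ n • t = 0 → t = 0 := by
    intro n
    induction n with
    | zero => intro t; simp
    | succ n ih =>
      intro t ht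
      rw [pow_succ, mul_smul] at ht
      exact Mx _ (ih _ ht)
  intro t s hts
  have hs : k.rTensor N s = 0 := by
    apply K1
    apply Fx
    rw [← map_smul, ← map_smul, ← hts, (ex2 _).2 ⟨t, rfl⟩, map_zero]
  obtain ⟨t', rfl⟩ := (ex2 _).1 hs
  refine ⟨t', ?_⟩
  rw [← sub_eq_zero]
  obtain ⟨n, hn⟩ := htor (t - x • t') (by rw [map_sub, map_smul, hts, sub_self])
  exact Mxn n _ hn

/-- elements of the kernel are `x`-power torsion, if the cokernel is locally flat. -/
theorem tors {R : Type} [CommRing R] [IsLocalRing R]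
    {x : R} (hx : x ∈ maximalIdeal R) {L M G : Type} (N : Type)
    [AddCommGroup L] [AddCommGroup M] [AddCommGroup G] [AddCommGroup N]
    [Module R L] [Module R M] [Module R G] [Module R N]
    (h : M →ₗ[R] G) (k : G →ₗ[R] L) (hh : Function.Injective h) (hk : Function.Surjective k)
    (hhk : Function.Exact h k)
    (hL : ∀ (p : Ideal R) (_ : p.IsPrime), p ≠ maximalIdeal R →
      Module.Flat R (LocalizedModule p.primeCompl L))
    (t : M ⊗[R] N) (ht : h.rTensor N t = 0) : ∃ n : ℕ, x ^ n • t = 0 := by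
  suffices hrad : x ∈ Ideal.radical (LinearMap.ker (LinearMap.toSpanSingleton R _ t)) by
    obtain ⟨n, hn⟩ := hrad
    exact ⟨n, by simpa using hn⟩
  rw [Ideal.radical_eq_sInf, Submodule.mem_sInf]
  rintro p ⟨hp, hprime⟩
  by_cases hpm : p = maximalIdeal R
  · rwa [hpm]
  exfalso
  have := hL p hprime hpm
  let T := Ideal.primeCompl p
  let hT : LocalizedModule T M →ₗ[R] LocalizedModule T G :=
    IsLocalizedModule.map T (LocalizedModule.mkLinearMap T M) (LocalizedModule.mkLinearMap T G) h
  let kT : LocalizedModule T G →ₗ[R] LocalizedModule T L :=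
    IsLocalizedModule.map T (LocalizedModule.mkLinearMap T G) (LocalizedModule.mkLinearMap T L) k
  have i1 : Function.Injective hT := IsLocalizedModule.map_injective _ _ _ _ hh
  have i2 : Function.Surjective kT := IsLocalizedModule.map_surjective _ _ _ _ hk
  have i3 : Function.Exact hT kT := IsLocalizedModule.map_exact _ _ _ _ _ _ hhk
  have i4 := LinearMap.lTensor_injective_of_exact_of_flat kT i2 hT i1 i3 N
  have i5 : Function.Injective (hT.rTensor N) := by
    rwa [LinearMap.lTensor_inj_iff_rTensor_inj] at i4
  have i6 : (LocalizedModule.mkLinearMap T M).rTensor N t = 0 := by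
    apply i5
    have : hT ∘ₗ LocalizedModule.mkLinearMap T M = LocalizedModule.mkLinearMap T G ∘ₗ h :=
      IsLocalizedModule.map_comp _ _ _ _
    rw [← LinearMap.comp_apply, ← LinearMap.rTensor_comp, this, LinearMap.rTensor_comp,
      LinearMap.comp_apply, ht, map_zero, map_zero]
  have i7 : IsLocalizedModule T ((LocalizedModule.mkLinearMap T M).rTensor N) :=
    IsLocalizedModule.rTensor (R := R) (A := R) T (N := N) (LocalizedModule.mkLinearMap T M)
  obtain ⟨s, hs⟩ := (IsLocalizedModule.eq_zero_iff T _).1 i6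
  apply s.2
  apply hp
  rw [LinearMap.mem_ker, LinearMap.toSpanSingleton_apply]
  exact hs

/-- the kernel in a sequence with free localised quotient is locally flat. -/
theorem flat_ker {R : Type} [CommRing R] (T : Submonoid R) {L M F : Type}
    [AddCommGroup L] [AddCommGroup M] [AddCommGroup F]
    [Module R L] [Module R M] [Module R F] [Module.Flat R F]
    (f : L →ₗ[R] F) (g : F →ₗ[R] M) (hf : Function.Injective f) (hg : Function.Surjective g)
    (hfg : Function.Exact f g) [Module.Free (Localization T) (LocalizedModule T M)] :
    Module.Flat R (LocalizedModule T L) := by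
  let fT := LocalizedModule.map T f
  let gT := LocalizedModule.map T g
  have i1 : Function.Injective fT := LocalizedModule.map_injective _ _ hf
  have i2 : Function.Surjective gT := LocalizedModule.map_surjective _ _ hg
  have i3 : Function.Exact fT gT := LocalizedModule.map_exact _ _ _ hfg
  obtain ⟨s, hs⟩ := Module.projective_lifting_property gT LinearMap.id i2
  have hsplit := (i3.split_tfae' (R := Localization T)).out 0 1
  obtain ⟨_, l, hl⟩ := hsplit.1 ⟨i1, s, hs⟩
  have : Module.Flat (Localization T) (LocalizedModule T F) := inferInstance
  have : Module.Flat (Localization T) (LocalizedModule T L) := Module.Flat.of_retract fT l hl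
  exact Module.Flat.trans R (Localization T) _

/-- reduction mod `x` -/
theorem flat_mod {R : Type} [CommRing R] (I : Ideal R) (F : Type) [AddCommGroup F] [Module R F]
    [Module.Free R F] : Module.Flat (R ⧸ I) (F ⧸ (I • (⊤ : Submodule R F))) := by
  let e := (quotTensorEquivQuotSMul F I).extendScalarsOfSurjective
    (S := R ⧸ I) Ideal.Quotient.mk_surjective
  exact Module.Flat.of_linearEquiv e.symm

/-- reduction of a linear map modulo an ideal -/
noncomputable def redMap {R : Type} [CommRing R] (I : Ideal R) {L F : Type} [AddCommGroup L]
    [AddCommGroup F] [Module R L] [Module R F] (f : L →ₗ[R] F) :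
    (L ⧸ (I • (⊤ : Submodule R L))) →ₗ[R ⧸ I] (F ⧸ (I • (⊤ : Submodule R F))) :=
  LinearMap.extendScalarsOfSurjective Ideal.Quotient.mk_surjective
    (Submodule.mapQ (I • (⊤ : Submodule R L)) (I • (⊤ : Submodule R F)) f (by
      rw [← Submodule.map_le_iff_le_comap, Submodule.map_smul'']
      exact smul_mono_right _ le_top))


theorem redMap_mk {R : Type} [CommRing R] (I : Ideal R) {L F : Type} [AddCommGroup L]
    [AddCommGroup F] [Module R L] [Module R F] (f : L →ₗ[R] F) (l : L) :
    redMap I f (Submodule.Quotient.mk l) = Submodule.Quotient.mk (f l) := rfl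

theorem mem_span_smul {R : Type} [CommRing R] (x : R) {L : Type} [AddCommGroup L] [Module R L]
    (l : L) : l ∈ Ideal.span {x} • (⊤ : Submodule R L) ↔ ∃ l', l = x • l' := by
  rw [Submodule.ideal_span_singleton_smul, Submodule.mem_smul_pointwise_iff_exists]
  simp [eq_comm]

/-- Exactness after reduction. -/
theorem red_exact {R : Type} [CommRing R] {x : R} {L F M : Type}
    [AddCommGroup L] [AddCommGroup M] [AddCommGroup F]
    [Module R L] [Module R M] [Module R F]
    (hM : ∀ m : M, x • m = 0 → m = 0)
    (f : L →ₗ[R] F) (g : F →ₗ[R] M) (hf : Function.Injective f) (hg : Function.Surjective g)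
    (hfg : Function.Exact f g) :
    Function.Injective (redMap (Ideal.span {x}) f) ∧
    Function.Surjective (redMap (Ideal.span {x}) g) ∧
    Function.Exact (redMap (Ideal.span {x}) f) (redMap (Ideal.span {x}) g) := by
  refine ⟨?_, ?_, ?_⟩
  · rw [injective_iff_map_eq_zero]
    intro l hl
    obtain ⟨l, rfl⟩ := Submodule.Quotient.mk_surjective _ l
    rw [redMap_mk, Submodule.Quotient.mk_eq_zero, mem_span_smul] at hl
    obtain ⟨s, hs⟩ := hl
    have h1 : g s = 0 := hM _ (by rw [← map_smul, ← hs]; exact (hfg _).2 ⟨l, rfl⟩)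
    obtain ⟨l', rfl⟩ := (hfg _).1 h1
    rw [Submodule.Quotient.mk_eq_zero, mem_span_smul]
    exact ⟨l', hf (by rw [hs, map_smul])⟩
  · intro m
    obtain ⟨m, rfl⟩ := Submodule.Quotient.mk_surjective _ m
    obtain ⟨s, rfl⟩ := hg m
    exact ⟨Submodule.Quotient.mk s, rfl⟩
  · intro s
    obtain ⟨s, rfl⟩ := Submodule.Quotient.mk_surjective _ s
    constructor
    · intro hs
      rw [redMap_mk, Submodule.Quotient.mk_eq_zero, mem_span_smul] at hs
      obtain ⟨m, hm⟩ := hs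
      obtain ⟨s', rfl⟩ := hg m
      obtain ⟨l, hl⟩ := (hfg (s - x • s')).1 (by rw [map_sub, map_smul, hm, sub_self])
      refine ⟨Submodule.Quotient.mk l, ?_⟩
      rw [redMap_mk, Submodule.Quotient.eq, mem_span_smul]
      exact ⟨-s', by rw [hl]; simp⟩
    · rintro ⟨l, hl⟩
      obtain ⟨l, rfl⟩ := Submodule.Quotient.mk_surjective _ l
      rw [← hl, redMap_mk, redMap_mk, (hfg _).2 ⟨l, rfl⟩]
      rfl

/-- `L ⊗ N → L/xL ⊗ N/xN` -/
noncomputable def redTensor {R : Type} [CommRing R] (I : Ideal R) (L N : Type) [AddCommGroup L]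
    [AddCommGroup N] [Module R L] [Module R N] :
    L ⊗[R] N →ₗ[R] (L ⧸ (I • (⊤ : Submodule R L))) ⊗[R ⧸ I] (N ⧸ (I • (⊤ : Submodule R N))) :=
  (TensorProduct.mapOfCompatibleSMul (R ⧸ I) R R _ _) ∘ₗ
    TensorProduct.map (Submodule.mkQ _) (Submodule.mkQ _)

theorem redTensor_tmul {R : Type} [CommRing R] (I : Ideal R) {L N : Type} [AddCommGroup L]
    [AddCommGroup N] [Module R L] [Module R N] (l : L) (n : N) :
    redTensor I L N (l ⊗ₜ n) = Submodule.Quotient.mk l ⊗ₜ Submodule.Quotient.mk n := rfl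

theorem redTensor_surj {R : Type} [CommRing R] (I : Ideal R) (L N : Type) [AddCommGroup L]
    [AddCommGroup N] [Module R L] [Module R N] : Function.Surjective (redTensor I L N) := by
  unfold redTensor
  rw [LinearMap.coe_comp]
  exact (TensorProduct.mapOfCompatibleSMul_surjective _ _ _ _ _).comp
    (TensorProduct.map_surjective (Submodule.mkQ_surjective _) (Submodule.mkQ_surjective _))

theorem redTensor_ker {R : Type} [CommRing R] (x : R) (L N : Type) [AddCommGroup L]
    [AddCommGroup N] [Module R L] [Module R N] (t : L ⊗[R] N) :
    redTensor (Ideal.span {x}) L N t = 0 ↔ ∃ t', t = x • t' := by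
  constructor
  · intro ht
    have hc : TensorProduct.CompatibleSMul R (R ⧸ Ideal.span {x})
        (L ⧸ (Ideal.span {x} • (⊤ : Submodule R L))) (N ⧸ (Ideal.span {x} • (⊤ : Submodule R N))) := by
      constructor
      intro r m n
      obtain ⟨r, rfl⟩ := Ideal.Quotient.mk_surjective r
      exact TensorProduct.smul_tmul (R := R) r m n
    have h1 : TensorProduct.map (Submodule.mkQ (Ideal.span {x} • (⊤ : Submodule R L)))
        (Submodule.mkQ (Ideal.span {x} • (⊤ : Submodule R N))) t = 0 :=
      (TensorProduct.equivOfCompatibleSMul (R ⧸ Ideal.span {x}) R R _ _).injective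
        (ht.trans (map_zero _).symm)
    have h2 : t ∈ LinearMap.ker (TensorProduct.map
        (Submodule.mkQ (Ideal.span {x} • (⊤ : Submodule R L)))
        (Submodule.mkQ (Ideal.span {x} • (⊤ : Submodule R N)))) := h1
    rw [TensorProduct.map_ker (LinearMap.exact_subtype_mkQ _) (Submodule.mkQ_surjective _)
      (LinearMap.exact_subtype_mkQ _) (Submodule.mkQ_surjective _)] at h2
    rw [← mem_span_smul]
    refine (sup_le ?_ ?_ : _ ≤ Ideal.span {x} • (⊤ : Submodule R (L ⊗[R] N))) h2
    · rintro _ ⟨s, rfl⟩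
      induction s with
      | zero => simp
      | add a b ha hb => rw [map_add]; exact Submodule.add_mem _ ha hb
      | tmul a b =>
        obtain ⟨b, hb⟩ := b
        obtain ⟨c, rfl⟩ := (mem_span_smul _ _).1 hb
        rw [mem_span_smul]
        exact ⟨a ⊗ₜ c, by simp⟩
    · rintro _ ⟨s, rfl⟩
      induction s with
      | zero => simp
      | add a b ha hb => rw [map_add]; exact Submodule.add_mem _ ha hb
      | tmul a b =>
        obtain ⟨a, hb⟩ := a
        obtain ⟨c, rfl⟩ := (mem_span_smul _ _).1 hb
        rw [mem_span_smul]
        exact ⟨c ⊗ₜ b, by simp [TensorProduct.smul_tmul']⟩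
  · rintro ⟨t', rfl⟩
    rw [map_smul]
    generalize redTensor (Ideal.span {x}) L N t' = y
    have : (x • y) = (Ideal.Quotient.mk (Ideal.span {x}) x) • y := rfl
    rw [this, Ideal.Quotient.eq_zero_iff_mem.2 (Ideal.mem_span_singleton_self x), zero_smul]

theorem injMod_iff {R : Type} [CommRing R] (x : R) {L F : Type} (N : Type)
    [AddCommGroup L] [AddCommGroup F] [AddCommGroup N] [Module R L] [Module R F] [Module R N]
    (f : L →ₗ[R] F) :
    Function.Injective ((redMap (Ideal.span {x}) f).rTensor
      (N ⧸ (Ideal.span {x} • (⊤ : Submodule R N)))) ↔ InjMod x N f := by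
  have cm : ∀ t, (redMap (Ideal.span {x}) f).rTensor
      (N ⧸ (Ideal.span {x} • (⊤ : Submodule R N))) (redTensor (Ideal.span {x}) L N t) =
      redTensor (Ideal.span {x}) F N (f.rTensor N t) := by
    intro t
    induction t with
    | zero => simp
    | add a b ha hb => simp only [map_add, ha, hb]
    | tmul a b => rfl
  rw [injective_iff_map_eq_zero]
  constructor
  · intro H t s hts
    rw [← redTensor_ker]
    apply H
    rw [cm, redTensor_ker]
    exact ⟨s, hts⟩
  · intro H t ht
    obtain ⟨t, rfl⟩ := redTensor_surj _ _ _ t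
    rw [cm, redTensor_ker] at ht
    obtain ⟨s, hs⟩ := ht
    rw [redTensor_ker]
    exact H t s hs

theorem main_aux {R : Type} [CommRing R] [IsNoetherianRing R] [IsLocalRing R]
    {x : R} (hx : x ∈ maximalIdeal R) {L F M G N : Type}
    [AddCommGroup L] [AddCommGroup F] [AddCommGroup M] [AddCommGroup G] [AddCommGroup N]
    [Module R L] [Module R F] [Module R M] [Module R G] [Module R N]
    [Module.Finite R L] [Module.Finite R M] [Module.Finite R N] [Module.Free R F] [Module.Free R G]
    (hN : ∀ n : N, x • n = 0 → n = 0)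
    (hM : ∀ n : M, x • n = 0 → n = 0)
    (hL : ∀ n : L, x • n = 0 → n = 0)
    (f : L →ₗ[R] F) (g : F →ₗ[R] M) (hf : Function.Injective f)
    (hg : Function.Surjective g) (hfg : Function.Exact f g)
    (h : M →ₗ[R] G) (k : G →ₗ[R] L) (hh : Function.Injective h)
    (hk : Function.Surjective k) (hhk : Function.Exact h k)
    (hloc : LocFreePunctured R M) (r : ℕ) :
    (Subsingleton (TorM (R ⧸ Ideal.span {x}) (r + 1)
        (M ⧸ ((Ideal.span {x}) • (⊤ : Submodule R M)))
        (N ⧸ ((Ideal.span {x}) • (⊤ : Submodule R N)))) →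
      Subsingleton (TorM (R ⧸ Ideal.span {x}) (r + 2)
        (M ⧸ ((Ideal.span {x}) • (⊤ : Submodule R M)))
        (N ⧸ ((Ideal.span {x}) • (⊤ : Submodule R N))))) ∧
    (Subsingleton (TorM (R ⧸ Ideal.span {x}) (r + 1)
        (L ⧸ ((Ideal.span {x}) • (⊤ : Submodule R L)))
        (N ⧸ ((Ideal.span {x}) • (⊤ : Submodule R N)))) →
      Subsingleton (TorM (R ⧸ Ideal.span {x}) (r + 2)
        (L ⧸ ((Ideal.span {x}) • (⊤ : Submodule R L)))
        (N ⧸ ((Ideal.span {x}) • (⊤ : Submodule R N))))) := by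
  have := flat_mod (Ideal.span {x}) F
  have := flat_mod (Ideal.span {x}) G
  obtain ⟨f1, f2, f3⟩ := red_exact hM f g hf hg hfg
  obtain ⟨h1, h2, h3⟩ := red_exact hL h k hh hk hhk
  obtain ⟨sM, sM1⟩ := tor_shift (N ⧸ ((Ideal.span {x}) • (⊤ : Submodule R N))) _ _ f1 f2 f3
  obtain ⟨sL, sL1⟩ := tor_shift (N ⧸ ((Ideal.span {x}) • (⊤ : Submodule R N))) _ _ h1 h2 h3
  rw [injMod_iff] at sM1 sL1
  have flM : ∀ (p : Ideal R) (_ : p.IsPrime), p ≠ maximalIdeal R →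
      Module.Flat R (LocalizedModule p.primeCompl M) := by
    intro p hp hpm
    have := hloc p hp hpm
    exact Module.Flat.trans R (Localization p.primeCompl) _
  have flL : ∀ (p : Ideal R) (_ : p.IsPrime), p ≠ maximalIdeal R →
      Module.Flat R (LocalizedModule p.primeCompl L) := by
    intro p hp hpm
    have := hloc p hp hpm
    exact flat_ker p.primeCompl f g hf hg hfg
  have c1 : InjMod x N f → InjMod x N h := core hx hN f g hg hfg h k hk hhk
    (tors hx N h k hh hk hhk flL)
  have c2 : InjMod x N h → InjMod x N f := core hx hN h k hk hhk f g hg hfg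
    (tors hx N f g hf hg hfg flM)
  induction r with
  | zero =>
    exact ⟨fun H => (sM 0).2 (sL1.2 (c1 (sM1.1 H))), fun H => (sL 0).2 (sM1.2 (c2 (sL1.1 H)))⟩
  | succ r ih =>
    exact ⟨fun H => (sM (r + 1)).2 (ih.2 ((sM r).1 H)),
      fun H => (sL (r + 1)).2 (ih.1 ((sL r).1 H))⟩

end CoreHelpers

theorem tor_rigid_mod_x
    (R : Type) [CommRing R] [IsNoetherianRing R] [IsLocalRing R]
    (M : Type) [AddCommGroup M] [Module R M] [Module.Finite R M]
    (hper : IsPeriodicSyzygy R M 2) (hloc : LocFreePunctured R M)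
    (x : R) (hx : x ∈ maximalIdeal R) (hreg : x ∈ nonZeroDivisors R) :
    ∀ (N : Type) [AddCommGroup N] [Module R N] [Module.Finite R N],
      Submodule.torsion R N = ⊥ →
      ∀ r : ℕ, 1 ≤ r →
        Subsingleton (TorM (R ⧸ Ideal.span {x}) r
          (M ⧸ ((Ideal.span {x}) • (⊤ : Submodule R M)))
          (N ⧸ ((Ideal.span {x}) • (⊤ : Submodule R N)))) →
        ∀ j : ℕ, r ≤ j →
          Subsingleton (TorM (R ⧸ Ideal.span {x}) j
            (M ⧸ ((Ideal.span {x}) • (⊤ : Submodule R M)))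
            (N ⧸ ((Ideal.span {x}) • (⊤ : Submodule R N)))) := by
  intro N _ _ _ hN
  have hNx : ∀ n : N, x • n = 0 → n = 0 := by
    intro n hn
    have : n ∈ Submodule.torsion R N := ⟨⟨x, hreg⟩, hn⟩
    simpa [hN] using this
  have hRx : ∀ (a : ℕ) (v : Fin a → R), x • v = 0 → v = 0 := by
    intro a v hv
    funext i
    have := congrFun hv i
    simp only [Pi.smul_apply, smul_eq_mul, Pi.zero_apply] at this
    exact (mul_left_mem_nonZeroDivisors_eq_zero_iff hreg).1 this
  obtain ⟨n, d, g, hg, hgd, hd, -, -, ⟨e⟩⟩ := hper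
  let h : M →ₗ[R] (Fin (n 1) → R) := (LinearMap.range (d 1)).subtype ∘ₗ e.toLinearMap
  have hh : Function.Injective h := (Submodule.injective_subtype _).comp e.injective
  have hhr : LinearMap.range h = LinearMap.range (d 1) := by
    rw [LinearMap.range_comp, LinearEquiv.range, Submodule.map_top, Submodule.range_subtype]
  have key := main_aux hx hNx (L := LinearMap.range (d 0)) (M := M)
    (fun m hm => hh (by rw [map_zero]; exact hRx _ _ (by rw [← map_smul, hm, map_zero])))
    (fun l hl => Subtype.ext (hRx _ _ (congrArg Subtype.val hl)))
    (LinearMap.range (d 0)).subtype g (Submodule.injective_subtype _) hg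
    (LinearMap.exact_iff.2 (by rw [Submodule.range_subtype, hgd]))
    h (d 0).rangeRestrict hh (LinearMap.surjective_rangeRestrict _)
    (LinearMap.exact_iff.2 (by rw [LinearMap.ker_rangeRestrict, hhr, hd 0])) hloc
  intro r hr H j hj
  induction j, hj using Nat.le_induction with
  | base => exact H
  | succ j hj ih =>
    obtain ⟨s, rfl⟩ : ∃ s, j = s + 1 := ⟨j - 1, by omega⟩
    exact (key s).1 ih
end

section
/- Let R be a Cohen-Macaulay local ring of dimension d with canonical module ω, and let M be a nonzero finitely generated R-module that is locally free on the punctured spectrum. Suppose d = 2nr and M ≅ Ω^{2n} M for positive integers n and r. Then M ⊗_R Hom_R(M, ω) has nonzero torsion submodule. -/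
open CategoryTheory IsLocalRing

section Helpers

open CategoryTheory IsLocalRing

/-- Yoneda/derived category version of Ext, as a type. -/
abbrev XT (R : Type) [CommRing R] (i : ℕ) (A B : Type) [AddCommGroup A] [Module R A]
    [AddCommGroup B] [Module R B] : Type :=
  CategoryTheory.Abelian.Ext (ModuleCat.of R A) (ModuleCat.of R B) i

variable {R : Type} [CommRing R]

section bridge

variable {A B : Type} [AddCommGroup A] [Module R A] [AddCommGroup B] [Module R B]

lemma extM_sub_iff (P : ProjectiveResolution (ModuleCat.of R A)) (i : ℕ) :
    Subsingleton (ExtM R i A B) ↔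
      (P.complex.linearYonedaObj R (ModuleCat.of R B)).ExactAt i := by
  rw [HomologicalComplex.exactAt_iff_isZero_homology]
  rw [← (P.isoExt (R := R) i (ModuleCat.of R B)).isZero_iff]
  exact (ModuleCat.isZero_iff_subsingleton).symm

lemma bridge_succ (i : ℕ) :
    Subsingleton (ExtM R (i+1) A B) ↔ Subsingleton (XT R (i+1) A B) := by
  let P := projectiveResolution (ModuleCat.of R A)
  rw [extM_sub_iff P, HomologicalComplex.exactAt_iff' _ i (i+1) (i+2) (by simp) (by simp),
    ShortComplex.moduleCat_exact_iff]
  constructor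
  · intro h
    refine ⟨fun a b => ?_⟩
    suffices ∀ a : XT R (i+1) A B, a = 0 by rw [this a, this b]
    intro a
    obtain ⟨f, hf, rfl⟩ := P.extMk_surjective a (i+2) rfl
    rw [P.extMk_eq_zero_iff _ _ _ _ i rfl]
    obtain ⟨g, hg⟩ := h f hf
    exact ⟨g, hg⟩
  · intro h f hf
    have := (P.extMk_eq_zero_iff f (i+2) rfl hf i rfl).1 (Subsingleton.elim _ _)
    exact this

lemma bridge_zero (h : Subsingleton (ExtM R 0 A B)) : Subsingleton (A →ₗ[R] B) := by
  let P := projectiveResolution (ModuleCat.of R A)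
  rw [extM_sub_iff P, HomologicalComplex.exactAt_iff' _ 0 0 1 (by simp) (by simp),
    ShortComplex.moduleCat_exact_iff] at h
  refine ⟨fun a b => ?_⟩
  suffices ∀ a : A →ₗ[R] B, a = 0 by rw [this a, this b]
  intro a
  let q : P.complex.X 0 ⟶ ModuleCat.of R A := P.π.f 0
  have hq : P.complex.d 1 0 ≫ q = 0 := P.complex_d_comp_π_f_zero
  have hqe : Epi q := inferInstanceAs (Epi (P.π.f 0))
  obtain ⟨g, hg⟩ := h (q ≫ ModuleCat.ofHom a) (by
    change P.complex.d 1 0 ≫ (q ≫ ModuleCat.ofHom a) = 0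
    rw [← Category.assoc, hq, Limits.zero_comp])
  have h0 : q ≫ ModuleCat.ofHom a = 0 := by
    rw [← hg]
    have h00 : P.complex.d 0 0 = 0 := P.complex.shape _ _ (by simp)
    have : ∀ g : P.complex.X 0 ⟶ ModuleCat.of R B, P.complex.d 0 0 ≫ g = 0 := by
      intro g; rw [h00, Limits.zero_comp]
    exact this g
  have : ModuleCat.ofHom a = 0 := by
    rwa [← cancel_epi q, Limits.comp_zero]
  ext x
  exact congrArg (fun t => t.hom x) this

end bridge

lemma xt_zero_iff {A B : Type} [AddCommGroup A] [Module R A] [AddCommGroup B] [Module R B] :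
    Subsingleton (XT R 0 A B) ↔ Subsingleton (A →ₗ[R] B) :=
  (CategoryTheory.Abelian.Ext.addEquiv₀.trans ModuleCat.homAddEquiv).subsingleton_congr

section les

variable {A B C : Type} [AddCommGroup A] [Module R A] [AddCommGroup B] [Module R B]
  [AddCommGroup C] [Module R C] {Y : Type} [AddCommGroup Y] [Module R Y]

/-- short exactness data -/
structure SES (f : A →ₗ[R] B) (g : B →ₗ[R] C) : Prop where
  inj : Function.Injective f
  surj : Function.Surjective g
  ex : Function.Exact f g

variable {f : A →ₗ[R] B} {g : B →ₗ[R] C}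

def SES.sc (h : SES f g) : ShortComplex (ModuleCat R) :=
  ModuleCat.shortComplexOfCompEqZero f g h.ex.linearMap_comp_eq_zero

lemma SES.se (h : SES f g) : (h.sc).ShortExact where
  exact := ModuleCat.shortComplex_exact _ h.ex
  mono_f := by simpa [SES.sc, ModuleCat.mono_iff_injective] using! h.inj
  epi_g := by simpa [SES.sc, ModuleCat.epi_iff_surjective] using! h.surj

lemma sub_of_zero {E : Type*} [AddCommGroup E] (h : ∀ x : E, x = 0) : Subsingleton E :=
  ⟨fun a b => by rw [h a, h b]⟩

open CategoryTheory.Abelian in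
lemma SES.con2 (h : SES f g) (i : ℕ) (h1 : Subsingleton (XT R i A Y))
    (h3 : Subsingleton (XT R i C Y)) : Subsingleton (XT R i B Y) := by
  refine sub_of_zero fun x => ?_
  obtain ⟨y, hy⟩ := Ext.contravariant_sequence_exact₂ h.se (ModuleCat.of R Y) (n := i) x
    (h1.elim _ _)
  rw [← hy, show y = 0 from h3.elim _ _, Ext.comp_zero]; rfl

open CategoryTheory.Abelian in
lemma SES.con1 (h : SES f g) (i : ℕ) (h2 : Subsingleton (XT R i B Y))
    (h3 : Subsingleton (XT R (i+1) C Y)) : Subsingleton (XT R i A Y) := by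
  refine sub_of_zero fun x => ?_
  obtain ⟨y, hy⟩ := Ext.contravariant_sequence_exact₁ h.se (ModuleCat.of R Y) (n₀ := i) x
    (add_comm 1 i) (h3.elim _ _)
  rw [← hy, show y = 0 from h2.elim _ _, Ext.comp_zero]; rfl

open CategoryTheory.Abelian in
lemma SES.con3 (h : SES f g) (i : ℕ) (h1 : Subsingleton (XT R i A Y))
    (h2 : Subsingleton (XT R (i+1) B Y)) : Subsingleton (XT R (i+1) C Y) := by
  refine sub_of_zero fun x => ?_
  obtain ⟨y, hy⟩ := Ext.contravariant_sequence_exact₃ h.se (ModuleCat.of R Y) (n₁ := i+1) x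
    (h2.elim _ _) (add_comm 1 i)
  rw [← hy, show y = 0 from h1.elim _ _, Ext.comp_zero]; rfl

lemma SES.con3_zero (h : SES f g) (h2 : Subsingleton (XT R 0 B Y)) :
    Subsingleton (XT R 0 C Y) := by
  rw [xt_zero_iff] at *
  refine sub_of_zero fun x => ?_
  have : x ∘ₗ g = 0 := h2.elim _ _
  ext c
  obtain ⟨b, rfl⟩ := h.surj c
  exact LinearMap.congr_fun this b

/-- lifting homs through `Ext^1`-vanishing -/
lemma SES.con_lift (h : SES f g) (h3 : Subsingleton (XT R 1 C Y)) (φ : A →ₗ[R] Y) :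
    ∃ ψ : B →ₗ[R] Y, ψ ∘ₗ f = φ := by
  obtain ⟨y, hy⟩ := Abelian.Ext.contravariant_sequence_exact₁ h.se (ModuleCat.of R Y) (n₀ := 0)
    (Abelian.Ext.mk₀ (ModuleCat.ofHom φ)) (n₁ := 1) rfl (h3.elim _ _)
  obtain ⟨ψ, rfl⟩ := (Abelian.Ext.mk₀_bijective _ _).2 y
  rw [Abelian.Ext.mk₀_comp_mk₀] at hy
  have := (Abelian.Ext.mk₀_bijective _ _).1 hy
  exact ⟨ψ.hom, congrArg ModuleCat.Hom.hom this⟩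

open CategoryTheory.Abelian in
lemma SES.cov2 (h : SES f g) (i : ℕ) (h1 : Subsingleton (XT R i Y A))
    (h3 : Subsingleton (XT R i Y C)) : Subsingleton (XT R i Y B) := by
  refine sub_of_zero fun x => ?_
  obtain ⟨y, hy⟩ := Ext.covariant_sequence_exact₂ (ModuleCat.of R Y) h.se (n := i) x
    (h3.elim _ _)
  rw [← hy, show y = 0 from h1.elim _ _, Ext.zero_comp]; rfl

open CategoryTheory.Abelian in
lemma SES.cov3 (h : SES f g) (i : ℕ) (h2 : Subsingleton (XT R i Y B))
    (h1 : Subsingleton (XT R (i+1) Y A)) : Subsingleton (XT R i Y C) := by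
  refine sub_of_zero fun x => ?_
  obtain ⟨y, hy⟩ := Ext.covariant_sequence_exact₃ (ModuleCat.of R Y) h.se (n₀ := i) x
    rfl (h1.elim _ _)
  rw [← hy, show y = 0 from h2.elim _ _, Ext.zero_comp]; rfl

open CategoryTheory.Abelian in
lemma SES.cov1 (h : SES f g) (i : ℕ) (h3 : Subsingleton (XT R i Y C))
    (h2 : Subsingleton (XT R (i+1) Y B)) : Subsingleton (XT R (i+1) Y A) := by
  refine sub_of_zero fun x => ?_
  obtain ⟨y, hy⟩ := Ext.covariant_sequence_exact₁ (ModuleCat.of R Y) h.se (n₁ := i+1) x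
    (h2.elim _ _) rfl
  rw [← hy, show y = 0 from h3.elim _ _, Ext.zero_comp]; rfl

/-- postcomposition -/
noncomputable def xpost {A' B' : Type} [AddCommGroup A'] [Module R A'] [AddCommGroup B']
    [Module R B'] (i : ℕ) (φ : A' →ₗ[R] B') (x : XT R i Y A') : XT R i Y B' :=
  Abelian.Ext.comp x (Abelian.Ext.mk₀ (ModuleCat.ofHom φ)) (add_zero i)

open CategoryTheory.Abelian in
/-- injectivity of the first map on `Ext^{i+1}` -/
lemma SES.cov_inj (h : SES f g) (i : ℕ) (h3 : Subsingleton (XT R i Y C))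
    (x : XT R (i+1) Y A) (hx : xpost (i+1) f x = 0) : x = 0 := by
  obtain ⟨y, hy⟩ := Ext.covariant_sequence_exact₁ (ModuleCat.of R Y) h.se (n₁ := i+1) x
    hx rfl
  rw [← hy, show y = 0 from h3.elim _ _, Ext.zero_comp]; rfl

lemma xpost_comp (i : ℕ) (f : A →ₗ[R] B) (g : B →ₗ[R] C) (x : XT R i Y A) :
    xpost i (g ∘ₗ f) x = xpost i g (xpost i f x) := by
  simp [xpost]

lemma xpost_id (i : ℕ) (x : XT R i Y A) : xpost i LinearMap.id x = x := by
  simp [xpost]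

lemma xpost_add (i : ℕ) (f g : A →ₗ[R] B) (x : XT R i Y A) :
    xpost i (f + g) x = xpost i f x + xpost i g x := by
  have : ModuleCat.ofHom (f + g) = ModuleCat.ofHom f + ModuleCat.ofHom g := rfl
  rw [xpost, this, Abelian.Ext.mk₀_add, Abelian.Ext.comp_add]; rfl

lemma xpost_smul (i : ℕ) (r : R) (f : A →ₗ[R] B) (x : XT R i Y A) :
    xpost i (r • f) x = r • xpost i f x := by
  have : ModuleCat.ofHom (r • f) = r • ModuleCat.ofHom f := rfl
  rw [xpost, this, Abelian.Ext.mk₀_smul, Abelian.Ext.comp_smul]; rfl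

/-- elements annihilating the first argument annihilate Ext -/
lemma xt_smul_eq_zero (i : ℕ) (r : R) (hr : ∀ y : Y, r • y = 0) (x : XT R i Y A) : r • x = 0 := by
  have smul_eq : r • x = (Abelian.Ext.mk₀ (r • 𝟙 (ModuleCat.of R Y))).comp x (zero_add i) := by
    simp [Abelian.Ext.mk₀_smul]
  have h0 : r • 𝟙 (ModuleCat.of R Y) = 0 := by
    ext y; exact hr y
  rw [smul_eq, h0]; simp

lemma SES.of_equiv (e : A ≃ₗ[R] B) : SES e.toLinearMap (0 : B →ₗ[R] PUnit) where
  inj := e.injective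
  surj := fun x => ⟨0, rfl⟩
  ex := fun b => by simp

end les

end Helpers

section CommAlg

open CategoryTheory IsLocalRing

variable {R : Type} [CommRing R]

lemma xt_sub_of_sub (i : ℕ) (N Y : Type) [AddCommGroup N] [Module R N] [AddCommGroup Y] [Module R Y]
    [Subsingleton N] : Subsingleton (XT R i N Y) :=
  sub_of_zero fun x => by
    have := xt_smul_eq_zero i (1 : R) (fun y : N => Subsingleton.elim _ _) x
    rwa [one_smul] at this

lemma xt_sub_equiv {N N' : Type} [AddCommGroup N] [Module R N] [AddCommGroup N'] [Module R N']
    (e : N ≃ₗ[R] N') (i : ℕ) (Y : Type) [AddCommGroup Y] [Module R Y]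
    (h : Subsingleton (XT R i N Y)) : Subsingleton (XT R i N' Y) :=
  (SES.of_equiv e).con2 i h (xt_sub_of_sub i _ _)

lemma xt_sub_equiv_right {N N' : Type} [AddCommGroup N] [Module R N] [AddCommGroup N'] [Module R N']
    (e : N ≃ₗ[R] N') (i : ℕ) (Y : Type) [AddCommGroup Y] [Module R Y]
    (h : Subsingleton (XT R i Y N)) : Subsingleton (XT R i Y N') := by
  refine sub_of_zero fun x => ?_
  have h1 : xpost i (e.toLinearMap ∘ₗ e.symm.toLinearMap) x = x := by
    rw [show e.toLinearMap ∘ₗ e.symm.toLinearMap = LinearMap.id by ext; simp, xpost_id]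
  rw [← h1, xpost_comp, h.elim (xpost i e.symm.toLinearMap x) 0]
  simp [xpost]

lemma xt_sub_free (i : ℕ) (N Y : Type) [AddCommGroup N] [Module R N] [AddCommGroup Y] [Module R Y]
    [Module.Projective R N] : Subsingleton (XT R (i+1) N Y) := by
  have : Projective (ModuleCat.of R N) := (IsProjective.iff_projective N).1 inferInstance
  exact sub_of_zero fun x => Abelian.Ext.eq_zero_of_projective _

lemma ses_sub {N : Type} [AddCommGroup N] [Module R N] (K : Submodule R N) :
    SES K.subtype K.mkQ where
  inj := K.injective_subtype
  surj := K.mkQ_surjective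
  ex := LinearMap.exact_subtype_mkQ K

lemma ses_ker {N P : Type} [AddCommGroup N] [Module R N] [AddCommGroup P] [Module R P]
    (g : N →ₗ[R] P) (hg : Function.Surjective g) :
    SES (LinearMap.ker g).subtype g where
  inj := Submodule.injective_subtype _
  surj := hg
  ex := LinearMap.exact_subtype_ker_map g

lemma xt_finite [IsNoetherianRing R] (i : ℕ) (Y : Type) [AddCommGroup Y] [Module R Y]
    [Module.Finite R Y] : ∀ (N : Type) [AddCommGroup N] [Module R N]
    [Module.Finite R N], Module.Finite R (XT R i N Y) := by
  induction i with
  | zero =>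
    intro N _ _ _
    exact Module.Finite.equiv
      ((Abelian.Ext.linearEquiv₀ (R := R) (X := ModuleCat.of R N) (Y := ModuleCat.of R Y)).trans
        ModuleCat.homLinearEquiv).symm
  | succ i ih =>
    intro N _ _ _
    obtain ⟨n, g, hg⟩ := Module.Finite.exists_fin' R N
    have h := ses_ker g hg
    have hfin : Module.Finite R (XT R i (LinearMap.ker g) Y) := ih (LinearMap.ker g)
    let F : XT R i (LinearMap.ker g) Y →ₗ[R] XT R (i+1) N Y :=
      (Abelian.Ext.bilinearCompOfLinear R _ _ (ModuleCat.of R Y) 1 i (i+1) (add_comm 1 i)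
      h.se.extClass)
    refine Module.Finite.of_surjective F ?_
    intro x
    exact Abelian.Ext.contravariant_sequence_exact₃ h.se (ModuleCat.of R Y) (n₁ := i+1) x
      ((xt_sub_free i (Fin n → R) Y).elim _ _) (add_comm 1 i)

variable [IsLocalRing R] [IsNoetherianRing R]

open Pointwise in
lemma nak (i : ℕ) (N Y : Type) [AddCommGroup N] [Module R N] [AddCommGroup Y] [Module R Y]
    [Module.Finite R N] [Module.Finite R Y] (x : R) (hx : x ∈ maximalIdeal R)
    (hreg : IsSMulRegular N x) (h : Subsingleton (XT R (i+1) (QuotSMulTop x N) Y)) :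
    Subsingleton (XT R i N Y) := by
  have := xt_finite (R := R) i Y N
  have key : ∀ y : XT R i N Y, ∃ z : XT R i N Y, x • z = y := by
    intro y
    have hS : (ModuleCat.smulShortComplex (ModuleCat.of R N) x).ShortExact :=
      IsSMulRegular.smulShortComplex_shortExact hreg
    obtain ⟨z, hz⟩ := Abelian.Ext.contravariant_sequence_exact₁ hS (ModuleCat.of R Y) (n₀ := i) y
      (add_comm 1 i) (h.elim _ _)
    refine ⟨(z : XT R i N Y), ?_⟩
    have smul_eq : ∀ z : XT R i N Y,
        x • z = (Abelian.Ext.mk₀ (x • 𝟙 (ModuleCat.of R N))).comp z (zero_add i) := by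
      intro z
      simp [Abelian.Ext.mk₀_smul]
    exact (smul_eq z).trans hz
  have : (⊤ : Submodule R (XT R i N Y)) = ⊥ := by
    refine Submodule.eq_bot_of_le_smul_of_le_jacobson_bot (maximalIdeal R) _
      Module.Finite.fg_top ?_ (IsLocalRing.jacobson_eq_maximalIdeal ⊥ bot_ne_top).ge
    intro y _
    obtain ⟨z, rfl⟩ := key y
    exact Submodule.smul_mem_smul hx trivial
  exact (Submodule.subsingleton_iff R).1 (subsingleton_of_bot_eq_top this.symm)

lemma exists_reg (N : Type) [AddCommGroup N] [Module R N] [Module.Finite R N]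
    (h : Subsingleton (resF R →ₗ[R] N)) : ∃ x ∈ maximalIdeal R, IsSMulRegular N x := by
  obtain ⟨x, hx, h⟩ := IsSMulRegular.subsingleton_linearMap_iff.1 h
  rw [Ideal.annihilator_quotient] at hx
  exact ⟨x, hx, h⟩

variable {ω : Type} [AddCommGroup ω] [Module R ω] [Module.Finite R ω] {d : ℕ}

open Pointwise in
lemma vanish_gt_aux (hk : ∀ i, d < i → Subsingleton (XT R i (resF R) ω)) (I : Ideal R) :
    ∀ (N : Type) [AddCommGroup N] [Module R N] [Module.Finite R N],
      I ≤ Module.annihilator R N → ∀ i, d < i → Subsingleton (XT R i N ω) := by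
  induction I using IsNoetherian.induction with
  | _ I ih =>
  intro N _ _ hN
  induction hN using IsNoetherianRing.induction_on_isQuotientEquivQuotientPrime R with
  | subsingleton N => intro _ i _; exact xt_sub_of_sub _ _ _
  | quotient N p e =>
    intro hI i hi
    refine xt_sub_equiv e.symm i ω ?_
    by_cases hpm : p.1 = maximalIdeal R
    · exact xt_sub_equiv (Submodule.quotEquivOfEq _ _ hpm.symm) i ω (hk i hi)
    · have hle : p.1 ≤ maximalIdeal R := IsLocalRing.le_maximalIdeal p.2.ne_top
      obtain ⟨x, hxm, hxp⟩ := SetLike.exists_of_lt (lt_of_le_of_ne hle hpm)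
      have hIp : I ≤ p.1 := by
        rw [e.annihilator_eq, Ideal.annihilator_quotient] at hI
        exact hI
      refine nak i _ ω x hxm ?_ (ih (I ⊔ Ideal.span {x}) ?_ _ ?_ _ (by omega))
      · intro a b hab
        obtain ⟨a, rfl⟩ := Ideal.Quotient.mk_surjective a
        obtain ⟨b, rfl⟩ := Ideal.Quotient.mk_surjective b
        rw [Ideal.Quotient.eq]
        have : Ideal.Quotient.mk p.1 (x * a) = Ideal.Quotient.mk p.1 (x * b) := hab
        rw [Ideal.Quotient.eq, ← mul_sub] at this
        exact (p.2.mem_or_mem this).resolve_left hxp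
      · refine lt_of_le_of_ne le_sup_left fun h => hxp (hIp ?_)
        rw [h]; exact Ideal.mem_sup_right (Ideal.mem_span_singleton_self x)
      · rw [sup_le_iff, Ideal.span_singleton_le_iff_mem]
        constructor
        · intro r hr
          rw [Module.mem_annihilator]
          intro m
          obtain ⟨m, rfl⟩ := Submodule.mkQ_surjective _ m
          obtain ⟨m, rfl⟩ := Ideal.Quotient.mk_surjective m
          rw [← map_smul]
          have : r • (Ideal.Quotient.mk p.1 m) = 0 := by
            change Ideal.Quotient.mk p.1 (r * m) = 0
            rw [Ideal.Quotient.eq_zero_iff_mem]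
            exact p.1.mul_mem_right _ (hIp hr)
          rw [this, map_zero]
        · rw [Module.mem_annihilator]
          intro m
          obtain ⟨m, rfl⟩ := Submodule.mkQ_surjective _ m
          rw [← map_smul, Submodule.mkQ_apply, Submodule.Quotient.mk_eq_zero]
          exact Submodule.smul_mem_pointwise_smul _ _ _ trivial
  | exact N₁ N₂ N₃ f g hf hg hfg h1 h3 =>
    intro hI i hi
    exact (SES.mk hf hg hfg).con2 i
      (h1 (hI.trans (f.annihilator_le_of_injective hf)) i hi)
      (h3 (hI.trans (g.annihilator_le_of_surjective hg)) i hi)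

lemma vanish_gt (hk : ∀ i, d < i → Subsingleton (XT R i (resF R) ω))
    (N : Type) [AddCommGroup N] [Module R N] [Module.Finite R N] (i : ℕ) (hi : d < i) :
    Subsingleton (XT R i N ω) :=
  vanish_gt_aux hk ⊥ N bot_le i hi

open Pointwise in
lemma ses_quot {N : Type} [AddCommGroup N] [Module R N] (x : R) (h : IsSMulRegular N x) :
    SES (LinearMap.lsmul R N x) (Submodule.mkQ (x • (⊤ : Submodule R N))) where
  inj := h
  surj := Submodule.mkQ_surjective _
  ex := LinearMap.exact_lsmul_mkQ_smul_top N x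

/-- depth lemma -/
lemma depth_vanish (hk : ∀ i, d < i → Subsingleton (XT R i (resF R) ω)) (t : ℕ) :
    ∀ (N : Type) [AddCommGroup N] [Module R N] [Module.Finite R N],
    (∀ j, j < t → Subsingleton (XT R j (resF R) N)) →
    ∀ i, d < i + t → Subsingleton (XT R i N ω) := by
  induction t with
  | zero => intro N _ _ _ _ i hi; exact vanish_gt hk N i hi
  | succ t ih =>
    intro N _ _ _ h i hi
    obtain ⟨x, hx, hreg⟩ := exists_reg N (xt_zero_iff.1 (h 0 (by omega)))
    refine nak i N ω x hx hreg (ih _ ?_ _ (by omega))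
    intro j hj
    exact (ses_quot x hreg).cov3 j (h j (by omega)) (h (j+1) (by omega))

open Pointwise in
/-- the total vanishing of `Ext(N, ω)` forces `N = 0` -/
lemma faithful_aux (hk : ∀ i, d < i → Subsingleton (XT R i (resF R) ω))
    (hkd : ¬ Subsingleton (XT R d (resF R) ω)) (I : Ideal R) :
    ∀ (N : Type) [AddCommGroup N] [Module R N] [Module.Finite R N],
      I = Module.annihilator R N → (∀ i, Subsingleton (XT R i N ω)) → Subsingleton N := by
  induction I using IsNoetherian.induction with
  | _ I ih =>
  intro N _ _ _ hI h
  by_contra hN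
  rw [not_subsingleton_iff_nontrivial] at hN
  by_cases hsub : Subsingleton (resF R →ₗ[R] N)
  · obtain ⟨x, hx, hreg⟩ := exists_reg N hsub
    have hxI : x ∉ I := by
      rw [hI, Module.mem_annihilator]
      intro h0
      obtain ⟨a, ha⟩ := exists_ne (0 : N)
      exact ha (hreg (by simp only [h0]))
    have hq : Subsingleton (QuotSMulTop x N) := by
      refine ih (Module.annihilator R (QuotSMulTop x N)) ?_ _ rfl ?_
      · refine lt_of_le_of_ne ?_ ?_
        · rw [hI]
          exact LinearMap.annihilator_le_of_surjective (Submodule.mkQ _) (Submodule.mkQ_surjective _)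
        · intro he
          apply hxI
          change I = _ at he
          rw [he, Module.mem_annihilator]
          intro m
          obtain ⟨m, rfl⟩ := Submodule.mkQ_surjective _ m
          rw [← map_smul, Submodule.mkQ_apply, Submodule.Quotient.mk_eq_zero]
          exact Submodule.smul_mem_pointwise_smul _ _ _ trivial
      · intro i
        cases i with
        | zero => exact (ses_quot x hreg).con3_zero (h 0)
        | succ i => exact (ses_quot x hreg).con3 i (h i) (h (i+1))
    have htop : x • (⊤ : Submodule R N) = ⊤ := Submodule.Quotient.subsingleton_iff.1 hq
    have : (⊤ : Submodule R N) = ⊥ := by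
      refine Submodule.eq_bot_of_le_smul_of_le_jacobson_bot (maximalIdeal R) _
        Module.Finite.fg_top ?_ (IsLocalRing.jacobson_eq_maximalIdeal ⊥ bot_ne_top).ge
      intro y hy
      rw [← htop] at hy
      obtain ⟨z, -, rfl⟩ := Submodule.mem_smul_pointwise_iff_exists _ _ _ |>.1 hy
      exact Submodule.smul_mem_smul hx trivial
    exact top_ne_bot this
  · rw [not_subsingleton_iff_nontrivial] at hsub
    obtain ⟨φ, hφ⟩ := exists_ne (0 : resF R →ₗ[R] N)
    have : IsSimpleModule R (resF R) := by
      change IsSimpleModule R (R ⧸ maximalIdeal R)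
      rw [isSimpleModule_iff_isCoatom]
      exact (IsLocalRing.maximalIdeal.isMaximal R).out
    have hinj : Function.Injective φ := LinearMap.injective_of_ne_zero hφ
    have hs : SES φ (LinearMap.range φ).mkQ := ⟨hinj, Submodule.mkQ_surjective _, LinearMap.exact_map_mkQ_range φ⟩
    exact hkd (hs.con1 d (h d) (vanish_gt hk _ _ (by omega)))

end CommAlg

section Prep

open CategoryTheory IsLocalRing TensorProduct

variable {R : Type} [CommRing R]

lemma ses_pi (Z : Type) [AddCommGroup Z] [Module R Z] (m : ℕ) :
    SES (LinearMap.single R (fun _ : Fin (m+1) => Z) 0)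
      (LinearMap.funLeft R Z (Fin.succ : Fin m → Fin (m+1))) where
  inj := Pi.single_injective (M := fun _ : Fin (m+1) => Z) 0
  surj := LinearMap.funLeft_surjective_of_injective _ _ _ (Fin.succ_injective m)
  ex := by
    intro y
    constructor
    · intro hy
      refine ⟨y 0, ?_⟩
      ext j
      refine Fin.cases ?_ (fun j => ?_) j
      · simp
      · have := congrFun hy j
        simpa [LinearMap.funLeft, Fin.succ_ne_zero] using this.symm
    · rintro ⟨z, rfl⟩
      ext j
      simp [LinearMap.funLeft, Fin.succ_ne_zero]

lemma xt_pi_right (Y Z : Type) [AddCommGroup Y] [Module R Y] [AddCommGroup Z] [Module R Z]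
    (i m : ℕ) (h : Subsingleton (XT R i Y Z)) : Subsingleton (XT R i Y (Fin m → Z)) := by
  induction m with
  | zero =>
    exact xt_sub_equiv_right (LinearEquiv.ofSubsingleton PUnit (Fin 0 → Z)) i Y <| by
      refine sub_of_zero fun x => ?_
      rw [← xpost_id i x, show (LinearMap.id : PUnit →ₗ[R] PUnit) = (0 : R) • LinearMap.id from
        Subsingleton.elim _ _, xpost_smul, zero_smul]
  | succ m ih => exact (ses_pi Z m).cov2 i h ih

lemma xt_pi_left (Y Z : Type) [AddCommGroup Y] [Module R Y] [AddCommGroup Z] [Module R Z]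
    (i m : ℕ) (h : Subsingleton (XT R i Z Y)) : Subsingleton (XT R i (Fin m → Z) Y) := by
  induction m with
  | zero => exact xt_sub_of_sub _ _ _
  | succ m ih => exact (ses_pi Z m).con2 i h ih

lemma xt_dual (Y Z : Type) [AddCommGroup Y] [Module R Y] [AddCommGroup Z] [Module R Z]
    (i m : ℕ) (h : Subsingleton (XT R i Y Z)) : Subsingleton (XT R i Y ((Fin m → R) →ₗ[R] Z)) :=
  xt_sub_equiv_right ((Pi.basisFun R (Fin m)).constr R) i Y (xt_pi_right Y Z i m h)

lemma xt_tens (Y Z : Type) [AddCommGroup Y] [Module R Y] [AddCommGroup Z] [Module R Z]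
    (i m : ℕ) (h : Subsingleton (XT R i Z Y)) : Subsingleton (XT R i ((Fin m → R) ⊗[R] Z) Y) :=
  xt_sub_equiv ((TensorProduct.comm R _ _).trans (TensorProduct.piScalarRight R R Z (Fin m))).symm
    i Y (xt_pi_left Y Z i m h)

/-- `s` times the identity factors through a finite free module -/
def SplitBy (s : R) (X : Type) [AddCommGroup X] [Module R X] : Prop :=
  ∃ (a : ℕ) (u : X →ₗ[R] (Fin a → R)) (v : (Fin a → R) →ₗ[R] X), v ∘ₗ u = s • LinearMap.id

lemma splitBy_ses {s : R} {X Y : Type} [AddCommGroup X] [Module R X] [AddCommGroup Y] [Module R Y]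
    {m : ℕ} {ι : Y →ₗ[R] (Fin m → R)} {g : (Fin m → R) →ₗ[R] X} (h : SES ι g)
    (hs : SplitBy s X) : ∃ r : (Fin m → R) →ₗ[R] Y, r ∘ₗ ι = s • LinearMap.id := by
  obtain ⟨a, u, v, huv⟩ := hs
  obtain ⟨w, hw⟩ := Module.projective_lifting_property g v h.surj
  let r0 : (Fin m → R) →ₗ[R] (Fin m → R) := s • LinearMap.id - (w ∘ₗ u) ∘ₗ g
  have hr0 : ∀ y, r0 y ∈ LinearMap.range ι := by
    intro y
    refine (h.ex _).1 ?_
    have h1 := LinearMap.congr_fun huv (g y)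
    have h2 := LinearMap.congr_fun hw (u (g y))
    simp only [LinearMap.comp_apply, LinearMap.smul_apply, LinearMap.id_apply] at h1 h2
    simp [r0, h2, h1]
  let e := LinearEquiv.ofInjective ι h.inj
  refine ⟨e.symm.toLinearMap ∘ₗ r0.codRestrict _ hr0, ?_⟩
  ext y
  apply e.injective
  simp only [LinearMap.comp_apply, LinearEquiv.coe_coe, LinearEquiv.apply_symm_apply,
    LinearMap.smul_apply, LinearMap.id_apply]
  ext1
  have : g (ι y) = 0 := (h.ex _).2 ⟨y, rfl⟩
  simp [r0, e, this]

lemma splitBy_local [IsNoetherianRing R] (M : Type) [AddCommGroup M] [Module R M]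
    [Module.Finite R M] (p : Ideal R) [p.IsPrime]
    (hfree : Module.Free (Localization.AtPrime p) (LocalizedModule p.primeCompl M)) :
    ∃ s ∉ p, SplitBy s M := by
  have : Module.FinitePresentation R M := Module.finitePresentation_of_finite R M
  let f := LocalizedModule.mkLinearMap p.primeCompl M
  have : Module.Finite (Localization.AtPrime p) (LocalizedModule p.primeCompl M) :=
    Module.Finite.of_isLocalizedModule p.primeCompl f
  let b := Module.finBasis (Localization.AtPrime p) (LocalizedModule p.primeCompl M)
  let a := Module.finrank (Localization.AtPrime p) (LocalizedModule p.primeCompl M)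
  let φ : LocalizedModule p.primeCompl M ≃ₗ[R] (Fin a → Localization.AtPrime p) :=
    b.equivFun.restrictScalars R
  let fa : (Fin a → R) →ₗ[R] (Fin a → Localization.AtPrime p) :=
    LinearMap.pi fun i => Algebra.linearMap R (Localization.AtPrime p) ∘ₗ LinearMap.proj i
  have : IsLocalizedModule p.primeCompl fa := inferInstance
  obtain ⟨u, s1, hu⟩ := Module.FinitePresentation.exists_lift_of_isLocalizedModule p.primeCompl fa
    (φ.toLinearMap ∘ₗ f)
  obtain ⟨v, s2, hv⟩ := Module.FinitePresentation.exists_lift_of_isLocalizedModule p.primeCompl f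
    (φ.symm.toLinearMap ∘ₗ fa)
  obtain ⟨s3, h3⟩ := Module.Finite.exists_smul_of_comp_eq_of_isLocalizedModule p.primeCompl f
    (v ∘ₗ u) ((s2 * s1 : R) • LinearMap.id) (by
      rw [← LinearMap.comp_assoc, hv]
      ext x
      have h1 := LinearMap.congr_fun hu x
      simp only [LinearMap.comp_apply, LinearMap.smul_apply, LinearEquiv.coe_coe] at h1 ⊢
      rw [h1]
      simp [Submonoid.smul_def, mul_smul])
  refine ⟨s3 * (s2 * s1), ?_, a, u, (s3 : R) • v, ?_⟩
  · exact (s3 * (s2 * s1)).2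
  · rw [LinearMap.smul_comp, mul_smul]
    exact h3

variable [IsLocalRing R] [IsNoetherianRing R]

lemma torsion_vanish {ω : Type} [AddCommGroup ω] [Module R ω] [Module.Finite R ω] [Nontrivial ω]
    {d : ℕ} (hk : ∀ i, i < d → Subsingleton (XT R i (resF R) ω))
    (L : Type) [AddCommGroup L] [Module R L] [Module.Finite R L]
    (hL : ∀ p : Ideal R, p.IsPrime → p ≠ maximalIdeal R → ∃ s ∉ p, ∀ x : L, s • x = 0) :
    ∀ i, i < d → Subsingleton (XT R i L ω) := by
  have hlt : maximalIdeal R • (⊤ : Submodule R ω) < ⊤ := by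
    refine lt_top_iff_ne_top.2 fun h => ?_
    exact top_ne_bot (Submodule.eq_bot_of_le_smul_of_le_jacobson_bot (maximalIdeal R) (⊤ : Submodule R ω)
        Module.Finite.fg_top h.ge (IsLocalRing.jacobson_eq_maximalIdeal ⊥ bot_ne_top).ge)
  obtain ⟨rs, hlen, hmem, hreg⟩ := ModuleCat.exists_isRegular_of_exists_subsingleton_ext
    (maximalIdeal R) d (ModuleCat.of R ω) hlt (ModuleCat.of R (resF R))
    (by
      change Module.support R (R ⧸ maximalIdeal R) = _
      rw [Module.support_eq_zeroLocus, Ideal.annihilator_quotient]) hk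
  intro i hi
  refine ModuleCat.subsingleton_ext_of_exists_isRegular (maximalIdeal R) (ModuleCat.of R L) ?_
    (ModuleCat.of R ω) hlt rs hmem hreg i (hlen ▸ hi)
  intro p hp
  by_cases hpm : p.asIdeal = maximalIdeal R
  · rw [PrimeSpectrum.mem_zeroLocus, hpm]
  · exfalso
    obtain ⟨s, hs, h0⟩ := hL p.asIdeal p.2 hpm
    have := Module.mem_support_iff_of_finite.1 hp
    exact hs (this (Module.mem_annihilator.2 h0))

end Prep

section Syz

open CategoryTheory IsLocalRing TensorProduct

variable {R : Type} [CommRing R] [IsLocalRing R]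

/-- `Y` is a (minimal) first syzygy of `X` -/
def SyzStep (X Y : ModuleCat.{0} R) : Prop :=
  ∃ (m : ℕ) (ι : Y →ₗ[R] (Fin m → R)) (g : (Fin m → R) →ₗ[R] X), SES ι g ∧
    LinearMap.range ι ≤ maximalIdeal R • (⊤ : Submodule R (Fin m → R))

lemma exists_syz (M : Type) [AddCommGroup M] [Module R M] [Module.Finite R M] (q : ℕ) (hq : 1 ≤ q)
    (hper : IsPeriodicSyzygy R M q) :
    ∃ K : ℕ → ModuleCat.{0} R, K 0 = ModuleCat.of R M ∧ (∀ i, K (i + q) = K i) ∧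
      (∀ i, Module.Finite R (K i)) ∧ ∀ i, SyzStep (K i) (K (i+1)) := by
  obtain ⟨n, d, g, hg, h0, hex, hm0, hm, ⟨e⟩⟩ := hper
  obtain ⟨L, hL0, hL1⟩ : ∃ L : ℕ → ModuleCat.{0} R, L 0 = ModuleCat.of R M ∧
      ∀ i, L (i+1) = ModuleCat.of R (LinearMap.range (d i)) :=
    ⟨fun i => Nat.casesOn i (ModuleCat.of R M) (fun i => ModuleCat.of R (LinearMap.range (d i))),
      rfl, fun _ => rfl⟩
  have hLfin : ∀ i, Module.Finite R (L i) := by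
    intro i
    cases i with
    | zero => rw [hL0]; exact inferInstanceAs (Module.Finite R M)
    | succ i => rw [hL1]; exact inferInstanceAs (Module.Finite R (LinearMap.range (d i)))
  have hLstep : ∀ i, SyzStep (L i) (L (i+1)) := by
    intro i
    cases i with
    | zero =>
      rw [hL0, hL1]
      refine ⟨n 0, (LinearMap.range (d 0)).subtype, g, ⟨Submodule.injective_subtype _, hg, ?_⟩, ?_⟩
      · rw [LinearMap.exact_iff, Submodule.range_subtype, h0]
      · rw [Submodule.range_subtype]; exact hm 0
    | succ i =>
      rw [hL1, hL1]
      refine ⟨n (i+1), (LinearMap.range (d (i+1))).subtype, (d i).rangeRestrict,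
        ⟨Submodule.injective_subtype _, LinearMap.surjective_rangeRestrict _, ?_⟩, ?_⟩
      · rw [LinearMap.exact_iff, Submodule.range_subtype, LinearMap.ker_rangeRestrict, hex]
      · rw [Submodule.range_subtype]; exact hm (i+1)
  refine ⟨fun i => L (i % q), ?_, fun i => ?_, fun i => hLfin _, fun i => ?_⟩
  · simp [hL0]
  · simp
  · by_cases hi : i % q + 1 = q
    · have h1 : (i + 1) % q = 0 := by
        rw [Nat.add_mod]
        rcases Nat.lt_or_ge 1 q with h | h
        · rw [Nat.mod_eq_of_lt h, hi, Nat.mod_self]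
        · have : q = 1 := by omega
          subst this; omega
      obtain ⟨m, ι, g', hs, hr⟩ := hLstep (i % q)
      have e' : M ≃ₗ[R] L (i % q + 1) := by
        have h2 : i % q = q - 1 := by omega
        rw [h2, hL1]
        exact e
      dsimp only
      rw [h1, hL0]
      refine ⟨m, ι ∘ₗ e'.toLinearMap, g', ⟨hs.inj.comp e'.injective, hs.surj, ?_⟩, ?_⟩
      · rw [LinearMap.exact_iff, LinearMap.range_comp_of_range_eq_top _ e'.range]
        exact (LinearMap.exact_iff.1 hs.ex)
      · rw [LinearMap.range_comp_of_range_eq_top _ e'.range]; exact hr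
    · have h1 : (i + 1) % q = i % q + 1 := by
        have : i % q < q := Nat.mod_lt _ (by omega)
        rw [Nat.add_mod, Nat.mod_eq_of_lt (show 1 < q by omega)]
        exact Nat.mod_eq_of_lt (by omega)
      dsimp only
      rw [h1]
      exact hLstep _

lemma syz_period {K : ℕ → ModuleCat.{0} R} {q : ℕ} (h : ∀ i, K (i + q) = K i) (i r : ℕ) :
    K (i + q * r) = K i := by
  induction r with
  | zero => rfl
  | succ r ih => rw [Nat.mul_succ, ← add_assoc, h, ih]

lemma syz_splitBy {K : ℕ → ModuleCat.{0} R} (hstep : ∀ i, SyzStep (K i) (K (i+1))) (s : R)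
    (h0 : SplitBy s (K 0)) (i : ℕ) : SplitBy s (K i) := by
  induction i with
  | zero => exact h0
  | succ i ih =>
    obtain ⟨m, ι, g, hs, -⟩ := hstep i
    obtain ⟨r, hr⟩ := splitBy_ses hs ih
    exact ⟨m, ι, r, hr⟩

variable [IsNoetherianRing R] {ω : Type} [AddCommGroup ω] [Module R ω] [Module.Finite R ω] {d : ℕ}

/-- all higher Ext of syzygies in `ω` vanish -/
lemma syz_ext {K : ℕ → ModuleCat.{0} R} {q : ℕ} (hq : 1 ≤ q) (h : ∀ i, K (i + q) = K i)
    (hfin : ∀ i, Module.Finite R (K i)) (hstep : ∀ i, SyzStep (K i) (K (i+1)))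
    (hk : ∀ i, d < i → Subsingleton (XT R i (resF R) ω)) (i j : ℕ) :
    Subsingleton (XT R (j+1) (K i) ω) := by
  have key : ∀ N j, Subsingleton (XT R (j+1+N) (K i) ω) →
      Subsingleton (XT R (j+1) (K (i+N)) ω) := by
    intro N
    induction N with
    | zero => intro j h; exact h
    | succ N ih =>
      intro j h
      obtain ⟨m, ι, g, hs, -⟩ := hstep (i+N)
      refine hs.con1 (j+1) (xt_sub_free j _ _) (ih (j+1) ?_)
      rwa [show j+1+1+N = j+1+(N+1) by omega]
  have := hfin i
  have hN : d < q * (d+1) := by nlinarith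
  have := key (q * (d+1)) j (vanish_gt hk _ _ (by omega))
  rwa [syz_period h] at this

/-- the dual sequence -/
lemma dual_ses {X Y : ModuleCat.{0} R} {m : ℕ} {ι : Y →ₗ[R] (Fin m → R)}
    {g : (Fin m → R) →ₗ[R] X} (h : SES ι g) (h1 : Subsingleton (XT R 1 X ω)) :
    SES (g.lcomp R ω) (ι.lcomp R ω) where
  inj := by
    intro a b hab
    ext x
    obtain ⟨y, rfl⟩ := h.surj x
    exact LinearMap.congr_fun hab y
  surj := fun φ => h.con_lift h1 φ
  ex := by
    intro φ
    constructor
    · intro hφ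
      have hle : LinearMap.ker g ≤ LinearMap.ker φ := by
        intro y hy
        obtain ⟨z, rfl⟩ := (h.ex y).1 hy
        exact LinearMap.congr_fun hφ z
      let e := g.quotKerEquivOfSurjective h.surj
      refine ⟨(LinearMap.ker g).liftQ φ hle ∘ₗ e.symm.toLinearMap, ?_⟩
      refine LinearMap.ext fun y => ?_
      have : e.symm (g y) = (LinearMap.ker g).mkQ y := by
        rw [LinearEquiv.symm_apply_eq]; rfl
      simp [this]
    · rintro ⟨ψ, rfl⟩
      refine LinearMap.ext fun y => ?_
      have : g (ι y) = 0 := (h.ex _).2 ⟨y, rfl⟩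
      simp [this]

/-- depth of the duals of the syzygies -/
lemma dual_depth {K : ℕ → ModuleCat.{0} R} (hstep : ∀ i, SyzStep (K i) (K (i+1)))
    (hE : ∀ i, Subsingleton (XT R 1 (K i) ω))
    (hk : ∀ i, i < d → Subsingleton (XT R i (resF R) ω)) (j : ℕ) (hj : j < d) (i : ℕ) :
    Subsingleton (XT R j (resF R) (K i →ₗ[R] ω)) := by
  induction j generalizing i with
  | zero =>
    obtain ⟨m, ι, g, hs, -⟩ := hstep i
    have hd := dual_ses hs (hE i)
    have := xt_zero_iff.1 (xt_dual (resF R) ω 0 m (hk 0 hj))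
    rw [xt_zero_iff]
    refine sub_of_zero fun x => ?_
    have h0 : g.lcomp R ω ∘ₗ x = 0 := Subsingleton.elim _ _
    refine LinearMap.ext fun y => hd.inj ?_
    rw [LinearMap.zero_apply, map_zero]
    exact LinearMap.congr_fun h0 y
  | succ j ih =>
    obtain ⟨m, ι, g, hs, -⟩ := hstep i
    have hd := dual_ses hs (hE i)
    exact hd.cov1 j (ih (by omega) (i+1)) (xt_dual _ _ _ _ (hk _ hj))

/-- minimality kills Ext from the residue field -/
lemma minimal_zero {X : Type} [AddCommGroup X] [Module R X] {m : ℕ} (f : X →ₗ[R] (Fin m → R))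
    (Z : Type) [AddCommGroup Z] [Module R Z] [Module.Free R X] [Module.Finite R X]
    (hf : LinearMap.range f ≤ maximalIdeal R • (⊤ : Submodule R (Fin m → R))) (i : ℕ)
    (x : XT R i (resF R) ((Fin m → R) →ₗ[R] Z)) :
    xpost i (f.lcomp R Z) x = 0 := by
  have hkill : ∀ a ∈ maximalIdeal R, ∀ y : resF R, a • y = 0 := by
    intro a ha y
    obtain ⟨y, rfl⟩ := Ideal.Quotient.mk_surjective y
    change Ideal.Quotient.mk _ (a * y) = 0
    rw [Ideal.Quotient.eq_zero_iff_mem]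
    exact Ideal.mul_mem_right _ _ ha
  have hmem : f ∈ maximalIdeal R • (⊤ : Submodule R (X →ₗ[R] (Fin m → R))) := by
    let b := Module.Free.chooseBasis R X
    have hval : ∀ y ∈ maximalIdeal R • (⊤ : Submodule R (Fin m → R)), ∀ c : X →ₗ[R] R,
        c.smulRight y ∈ maximalIdeal R • (⊤ : Submodule R (X →ₗ[R] (Fin m → R))) := by
      intro y hy c
      induction hy using Submodule.smul_induction_on' with
      | smul a ha z hz =>
        have : c.smulRight (a • z) = a • c.smulRight z := by
          ext; simp [mul_left_comm]
        rw [this]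
        exact Submodule.smul_mem_smul ha trivial
      | add y _ z _ hy hz =>
        have : c.smulRight (y + z) = c.smulRight y + c.smulRight z := by
          ext; simp [mul_add]
        rw [this]
        exact add_mem hy hz
    have hsum : f = ∑ j, (b.coord j).smulRight (f (b j)) := by
      refine b.ext fun j => ?_
      classical
      simp [LinearMap.sum_apply, Finsupp.single_apply]
    rw [hsum]
    exact Submodule.sum_mem _ fun j _ => hval _ (hf ⟨_, rfl⟩) _
  clear hf
  induction hmem using Submodule.smul_induction_on' with
  | smul a ha z hz =>
    have : (a • z).lcomp R Z = a • z.lcomp R Z := by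
      ext φ y; simp
    rw [this, xpost_smul]
    exact xt_smul_eq_zero i a (hkill a ha) _
  | add y _ z _ hy hz =>
    have : (y + z).lcomp R Z = y.lcomp R Z + z.lcomp R Z := by
      ext φ y; simp
    rw [this, xpost_add, hy, hz, add_zero]

end Syz

section Main

open CategoryTheory IsLocalRing TensorProduct

variable {R : Type} [CommRing R] [IsLocalRing R] [IsNoetherianRing R]
  {ω : Type} [AddCommGroup ω] [Module R ω] [Module.Finite R ω] {d : ℕ}

section gen

variable {A B C : Type} [AddCommGroup A] [Module R A] [AddCommGroup B] [Module R B]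
  [AddCommGroup C] [Module R C] {f : A →ₗ[R] B} {g : B →ₗ[R] C}

lemma ses_range (h : Function.Exact f g) (hg : Function.Surjective g) :
    SES (LinearMap.range f).subtype g where
  inj := Submodule.injective_subtype _
  surj := hg
  ex := by
    rw [LinearMap.exact_iff, Submodule.range_subtype]
    exact LinearMap.exact_iff.1 h

lemma gen_step (h : Function.Exact f g) (hg : Function.Surjective g) (j : ℕ)
    (hL : Subsingleton (XT R j (LinearMap.ker f) ω))
    (hF : Subsingleton (XT R j B ω)) (hX : Subsingleton (XT R (j+1) C ω)) :
    Subsingleton (XT R j A ω) := by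
  have hB : Subsingleton (XT R j (LinearMap.range f) ω) := (ses_range h hg).con1 j hF hX
  have hs : SES (LinearMap.ker f).subtype f.rangeRestrict :=
    ⟨Submodule.injective_subtype _, LinearMap.surjective_rangeRestrict _, by
      rw [LinearMap.exact_iff, Submodule.range_subtype, LinearMap.ker_rangeRestrict]⟩
  exact hs.con2 j hL hB

lemma gen_last (h : Function.Exact f g) (hg : Function.Surjective g)
    (hL : Subsingleton (XT R 0 (LinearMap.ker f) ω))
    (hX : Subsingleton (XT R 1 C ω)) (φ : A →ₗ[R] ω) :
    ∃ ψ : B →ₗ[R] ω, ψ ∘ₗ f = φ := by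
  rw [xt_zero_iff] at hL
  have h0 : φ ∘ₗ (LinearMap.ker f).subtype = 0 := hL.elim _ _
  have hle : LinearMap.ker f ≤ LinearMap.ker φ := fun z hz =>
    LinearMap.congr_fun h0 ⟨z, hz⟩
  let e := f.quotKerEquivRange
  obtain ⟨ψ, hψ⟩ := (ses_range h hg).con_lift hX
    ((LinearMap.ker f).liftQ φ hle ∘ₗ e.symm.toLinearMap)
  refine ⟨ψ, LinearMap.ext fun z => ?_⟩
  have h1 := LinearMap.congr_fun hψ (f.rangeRestrict z)
  have h2 : e.symm (f.rangeRestrict z) = (LinearMap.ker f).mkQ z := by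
    rw [LinearEquiv.symm_apply_eq]; rfl
  simp only [LinearMap.comp_apply, LinearEquiv.coe_coe, h2] at h1
  exact h1

end gen

section step

variable {X Y T : Type} [AddCommGroup X] [Module R X] [AddCommGroup Y] [Module R Y]
  [AddCommGroup T] [Module R T] {m : ℕ} {ι : Y →ₗ[R] (Fin m → R)} {g : (Fin m → R) →ₗ[R] X}

lemma tens_step (h : SES ι g) (j : ℕ)
    (hL : Subsingleton (XT R j (LinearMap.ker (ι.rTensor T)) ω))
    (hF : Subsingleton (XT R j T ω)) (hX : Subsingleton (XT R (j+1) (X ⊗[R] T) ω)) :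
    Subsingleton (XT R j (Y ⊗[R] T) ω) :=
  gen_step (rTensor_exact T h.ex h.surj) (LinearMap.rTensor_surjective T h.surj) j hL
    (xt_tens ω T j m hF) hX

lemma tens_last (h : SES ι g)
    (hL : Subsingleton (XT R 0 (LinearMap.ker (ι.rTensor T)) ω))
    (hX : Subsingleton (XT R 1 (X ⊗[R] T) ω)) (φ : Y ⊗[R] T →ₗ[R] ω) :
    ∃ ψ : (Fin m → R) ⊗[R] T →ₗ[R] ω, ψ ∘ₗ ι.rTensor T = φ :=
  gen_last (rTensor_exact T h.ex h.surj) (LinearMap.rTensor_surjective T h.surj) hL hX φ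

lemma ker_killed (h : SES ι g) {s : R} (hs : SplitBy s X)
    (z : LinearMap.ker (ι.rTensor T)) : s • z = 0 := by
  obtain ⟨r, hr⟩ := splitBy_ses h hs
  ext1
  have h1 : (r.rTensor T ∘ₗ ι.rTensor T) z.1 = s • z.1 := by
    rw [← LinearMap.rTensor_comp, hr, LinearMap.rTensor_smul, LinearMap.rTensor_id]; rfl
  rw [LinearMap.comp_apply, LinearMap.mem_ker.1 z.2, map_zero] at h1
  exact h1.symm

end step

lemma core_s10 {K : ℕ → ModuleCat.{0} R} {q r : ℕ} (hq : 1 ≤ q) (hd : d = q * r) (hd1 : 1 ≤ d)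
    (h : ∀ i, K (i + q) = K i) (hfin : ∀ i, Module.Finite R (K i))
    (hstep : ∀ i, SyzStep (K i) (K (i+1)))
    (hk : ∀ i, i ≠ d → Subsingleton (XT R i (resF R) ω))
    (hkd : ¬ Subsingleton (XT R d (resF R) ω))
    (hR : Subsingleton (resF R →ₗ[R] R)) (hM : Nontrivial (K 0))
    (hloc : LocFreePunctured R (K 0)) :
    Submodule.torsion R ((K 0) ⊗[R] ((K 0) →ₗ[R] ω)) ≠ ⊥ := by
  intro htor
  have hgt : ∀ i, d < i → Subsingleton (XT R i (resF R) ω) := fun i hi => hk i (by omega)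
  have hlt : ∀ i, i < d → Subsingleton (XT R i (resF R) ω) := fun i hi => hk i (by omega)
  have hωn : Nontrivial ω := by
    by_contra hc
    rw [not_nontrivial_iff_subsingleton] at hc
    refine hkd (sub_of_zero fun x => ?_)
    rw [← xpost_id d x, show (LinearMap.id : ω →ₗ[R] ω) = (0 : R) • LinearMap.id from
      Subsingleton.elim _ _, xpost_smul, zero_smul]
  have hf0 := hfin 0
  have hE := syz_ext (ω := ω) (d := d) hq h hfin hstep hgt
  have hdd := dual_depth (ω := ω) (d := d) hstep (fun i => hE i 0) hlt
  set T := ((K 0) →ₗ[R] ω) with hT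
  have hTf : Module.Finite R T := inferInstance
  -- Ext of T
  have hTE : ∀ i, Subsingleton (XT R (i+1) T ω) := fun i =>
    depth_vanish hgt d T (fun j hj => hdd j hj 0) (i+1) (by omega)
  -- torsion-freeness
  have htop : Subsingleton (XT R d ((K 0) ⊗[R] T) ω) := by
    refine depth_vanish hgt 1 _ (fun j hj => ?_) d (by omega)
    obtain rfl : j = 0 := by omega
    rw [xt_zero_iff]
    refine sub_of_zero fun φ => LinearMap.ext fun y => ?_
    obtain ⟨x, hx, hreg⟩ := exists_reg R hR
    have hmem : φ y ∈ Submodule.torsion R ((K 0) ⊗[R] T) := by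
      rw [Submodule.mem_torsion_iff]
      refine ⟨⟨x, ?_⟩, ?_⟩
      · rw [mem_nonZeroDivisors_iff_right]
        intro z hz
        exact hreg (by simpa [mul_comm] using hz)
      · change x • φ y = 0
        rw [← map_smul]
        have : x • y = 0 := by
          obtain ⟨y, rfl⟩ := Ideal.Quotient.mk_surjective y
          change Ideal.Quotient.mk _ (x * y) = 0
          rw [Ideal.Quotient.eq_zero_iff_mem]
          exact Ideal.mul_mem_right _ _ hx
        rw [this, map_zero]
    rw [htor] at hmem
    exact hmem
  -- the kernels
  have hL : ∀ i m (ι : K (i+1) →ₗ[R] (Fin m → R)) (g : (Fin m → R) →ₗ[R] K i), SES ι g →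
      ∀ j, j < d → Subsingleton (XT R j (LinearMap.ker (ι.rTensor T)) ω) := by
    intro i m ι g hs
    have := hfin (i+1)
    refine torsion_vanish hlt _ ?_
    intro p hp hpm
    obtain ⟨s, hsp, hsplit⟩ := splitBy_local (K 0) p (hloc p hp hpm)
    exact ⟨s, hsp, ker_killed hs (syz_splitBy hstep s hsplit i)⟩
  -- descend
  have hdesc : ∀ i, i < d → Subsingleton (XT R (d - i) ((K i) ⊗[R] T) ω) := by
    intro i
    induction i with
    | zero => intro _; exact htop
    | succ i ih =>
      intro hi
      obtain ⟨m, ι, g, hs, -⟩ := hstep i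
      obtain ⟨j, hj⟩ : ∃ j, d - (i+1) = j + 1 := ⟨d - (i+1) - 1, by omega⟩
      have h1 := ih (by omega)
      rw [show d - i = j + 1 + 1 by omega] at h1
      rw [hj]
      exact tens_step hs (j+1) (hL i m ι g hs _ (by omega)) (hTE j) h1
  obtain ⟨D, rfl⟩ : ∃ D, d = D + 1 := ⟨d - 1, by omega⟩
  have hlast := hdesc D (by omega)
  rw [show D + 1 - D = 1 by omega] at hlast
  obtain ⟨m, ι, g, hs, hι⟩ := hstep D
  obtain ⟨m', ι', g', hs', -⟩ := hstep (D+1)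
  obtain ⟨e⟩ : Nonempty (K (D+1) ≃ₗ[R] K 0) := by
    have := syz_period h 0 r
    rw [zero_add, ← hd] at this
    rw [this]
    exact ⟨LinearEquiv.refl R _⟩
  let ev : K (D+1) ⊗[R] T →ₗ[R] ω :=
    TensorProduct.lift ((LinearMap.id : T →ₗ[R] T).flip ∘ₗ e.toLinearMap)
  obtain ⟨Ψ, hΨ⟩ := tens_last hs (hL D m ι g hs 0 (by omega)) hlast ev
  let s : T →ₗ[R] ((Fin m → R) →ₗ[R] ω) := (TensorProduct.curry Ψ).flip
  have hsec : ι.lcomp R ω ∘ₗ s = e.toLinearMap.lcomp R ω := by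
    refine LinearMap.ext fun t => LinearMap.ext fun y => ?_
    have := LinearMap.congr_fun hΨ (y ⊗ₜ t)
    have h2 : Ψ (ι y ⊗ₜ[R] t) = t (e y) := by simpa [ev] using this
    exact h2
  have hTd : Subsingleton (XT R (D+1) (resF R) T) := by
    refine sub_of_zero fun x => ?_
    have hinj := (dual_ses hs' (hE (D+1) 0)).cov_inj D (hdd D (by omega) (D+1+1))
      (xpost (D+1) (e.toLinearMap.lcomp R ω) x) (by
        rw [← hsec, xpost_comp, ← xpost_comp _ (ι.lcomp R ω)]
        have hc : g'.lcomp R ω ∘ₗ ι.lcomp R ω = (ι ∘ₗ g').lcomp R ω := rfl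
        rw [hc]
        exact minimal_zero _ _ ((LinearMap.range_comp_le_range _ _).trans hι) _ _)
    have hid : e.symm.toLinearMap.lcomp R ω ∘ₗ e.toLinearMap.lcomp R ω =
        (LinearMap.id : T →ₗ[R] T) := by
      refine LinearMap.ext fun t => LinearMap.ext fun y => ?_
      simp
    rw [← xpost_id (D+1) x, ← hid, xpost_comp, hinj]
    simp [xpost]
  have hT0 : Subsingleton T := by
    refine faithful_aux hgt hkd _ T rfl fun i => ?_
    refine depth_vanish hgt (D+1+1) T (fun j hj => ?_) i (by omega)
    rcases Nat.lt_succ_iff_lt_or_eq.1 hj with hj | rfl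
    · exact hdd j hj 0
    · exact hTd
  have : Subsingleton (K 0) := by
    refine faithful_aux hgt hkd _ (K 0) rfl fun i => ?_
    cases i with
    | zero => rw [xt_zero_iff]; exact hT0
    | succ i => exact hE 0 i
  exact not_subsingleton _ this

end Main

theorem torsion_in_tensor_with_canonical_dual
    (R : Type) [CommRing R] [IsNoetherianRing R] [IsLocalRing R]
    (d n r : ℕ) (hn : 1 ≤ n) (hr : 1 ≤ r) (hd : d = 2 * n * r)
    (hCM : IsCMOfDim R d)
    (ω : Type) [AddCommGroup ω] [Module R ω] (hω : IsCanonicalModule R d ω)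
    (M : Type) [AddCommGroup M] [Module R M] [Module.Finite R M]
    (hM : Nontrivial M) (hloc : LocFreePunctured R M)
    (hper : IsPeriodicSyzygy R M (2 * n)) :
    Submodule.torsion R (TensorProduct R M (M →ₗ[R] ω)) ≠ ⊥ := by
  obtain ⟨hωf, hω1, ⟨e⟩⟩ := hω
  obtain ⟨-, hCM, -⟩ := hCM
  have hd2 : 1 ≤ d := by
    rw [hd]; exact Nat.mul_pos (by omega) hr
  obtain ⟨K, hK0, hK, hfin, hstep⟩ := exists_syz M (2 * n) (by omega) hper
  have key := core_s10 (K := K) (q := 2 * n) (r := r) (d := d) (ω := ω) (by omega) hd hd2 hK hfin hstep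
    (fun i hi => by
      cases i with
      | zero => exact xt_zero_iff.2 (bridge_zero (hω1 0 hi))
      | succ i => exact (bridge_succ i).1 (hω1 _ hi))
    (fun hc => by
      obtain ⟨D, rfl⟩ : ∃ D, d = D + 1 := ⟨d - 1, by omega⟩
      have h1 := (bridge_succ D).2 hc
      have h2 : Subsingleton (resF R) := e.symm.toEquiv.subsingleton
      have h3 : Nontrivial (resF R) :=
        Ideal.Quotient.nontrivial_iff.2 (IsLocalRing.maximalIdeal.isMaximal R).ne_top
      exact not_subsingleton _ h2)
    (bridge_zero (hCM 0 (by omega)))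
  rw [hK0] at key
  exact key hM hloc
end

section
/- Let R be a local ring and M a finitely generated R-module with a finite free resolution of length at most depth_R(N) for a finitely generated R-module N. If Tor_i^R(M,N) has finite length for all i ≥ 1, then Tor_i^R(M,N) = 0 for all i ≥ 1. -/
open CategoryTheory IsLocalRing

namespace TV

open CategoryTheory IsLocalRing TensorProduct

/-- vanishing of `Ext^i`, in elementary terms -/
def EV {R : Type} [CommRing R] (P : ℕ → Type) [∀ i, AddCommGroup (P i)] [∀ i, Module R (P i)]
    (p : ∀ i, P (i + 1) →ₗ[R] P i) (Y : Type) [AddCommGroup Y] [Module R Y] : ℕ → Prop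
  | 0 => ∀ f : P 0 →ₗ[R] Y, f ∘ₗ p 0 = 0 → f = 0
  | i + 1 => ∀ f : P (i + 1) →ₗ[R] Y, f ∘ₗ p (i + 1) = 0 → ∃ g : P i →ₗ[R] Y, f = g ∘ₗ p i

section
variable {R : Type} [CommRing R] {P : ℕ → Type} [∀ i, AddCommGroup (P i)] [∀ i, Module R (P i)]
    {p : ∀ i, P (i + 1) →ₗ[R] P i}

lemma EV.of_equiv {Y Z : Type} [AddCommGroup Y] [Module R Y] [AddCommGroup Z] [Module R Z]
    (e : Y ≃ₗ[R] Z) {i : ℕ} (h : EV P p Y i) : EV P p Z i := by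
  cases i with
  | zero =>
    intro f hf
    have := h (e.symm.toLinearMap ∘ₗ f) (by rw [LinearMap.comp_assoc, hf, LinearMap.comp_zero])
    ext x
    have h2 := LinearMap.congr_fun this x
    simpa using h2
  | succ i =>
    intro f hf
    obtain ⟨g, hg⟩ := h (e.symm.toLinearMap ∘ₗ f)
      (by rw [LinearMap.comp_assoc, hf, LinearMap.comp_zero])
    refine ⟨e.toLinearMap ∘ₗ g, ?_⟩
    rw [LinearMap.comp_assoc, ← hg]
    ext x
    simp

lemma EV.pi {Y : Type} [AddCommGroup Y] [Module R Y] (n : ℕ) {i : ℕ} (h : EV P p Y i) :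
    EV P p (Fin n → Y) i := by
  cases i with
  | zero =>
    intro f hf
    ext x j
    have := h (LinearMap.proj j ∘ₗ f) (by rw [LinearMap.comp_assoc, hf, LinearMap.comp_zero])
    exact LinearMap.congr_fun this x
  | succ i =>
    intro f hf
    choose g hg using fun j => h (LinearMap.proj j ∘ₗ f)
      (by rw [LinearMap.comp_assoc, hf, LinearMap.comp_zero])
    refine ⟨LinearMap.pi g, ?_⟩
    ext x j
    exact LinearMap.congr_fun (hg j) x

lemma EV.free {Y : Type} [AddCommGroup Y] [Module R Y] (n : ℕ) {i : ℕ} (h : EV P p Y i) :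
    EV P p ((Fin n → R) ⊗[R] Y) i :=
  (h.pi n).of_equiv ((TensorProduct.comm R _ _ ≪≫ₗ TensorProduct.piScalarRight R R Y (Fin n)).symm)

lemma EV.ses [∀ i, Module.Projective R (P i)] (hp : ∀ i, p i ∘ₗ p (i + 1) = 0)
    {A B C : Type} [AddCommGroup A] [Module R A]
    [AddCommGroup B] [Module R B] [AddCommGroup C] [Module R C] (ι : A →ₗ[R] B) (π : B →ₗ[R] C)
    (hι : Function.Injective ι) (hex : Function.Exact ι π) (hπ : Function.Surjective π) {i : ℕ}
    (hB : EV P p B i) (hA : EV P p A (i + 1)) : EV P p C i := by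
  have key : ∀ f : P i →ₗ[R] C, f ∘ₗ p i = 0 → ∃ b : P i →ₗ[R] B, π ∘ₗ b = f ∧ b ∘ₗ p i = 0 := by
    intro f hf
    obtain ⟨f', hf'⟩ := Module.projective_lifting_property π f hπ
    have h1 : ∀ x, f' (p i x) ∈ LinearMap.range ι := by
      intro x
      rw [← (LinearMap.exact_iff.1 hex), LinearMap.mem_ker]
      have := LinearMap.congr_fun hf x
      rw [← hf'] at this
      exact this
    let e := LinearEquiv.ofInjective ι hι
    let a' : P (i+1) →ₗ[R] A := e.symm.toLinearMap ∘ₗ (LinearMap.codRestrict _ (f' ∘ₗ p i) h1)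
    have ha' : ι ∘ₗ a' = f' ∘ₗ p i := by
      ext x
      have : (e (a' x) : B) = f' (p i x) := by simp [a']
      exact this
    obtain ⟨a, ha⟩ := hA a' (by
      ext x
      apply hι
      have := LinearMap.congr_fun ha' (p (i+1) x)
      have h2 := LinearMap.congr_fun (hp i) x
      simp only [LinearMap.comp_apply, LinearMap.zero_apply] at this h2 ⊢
      rw [this, h2, map_zero, map_zero])
    refine ⟨f' - ι ∘ₗ a, ?_, ?_⟩
    · ext x
      have := LinearMap.congr_fun hf' x
      simpa [hex.apply_apply_eq_zero] using this
    · rw [LinearMap.sub_comp, LinearMap.comp_assoc, ← ha, ha', sub_self]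
  cases i with
  | zero =>
    intro f hf
    obtain ⟨b, hb, hb'⟩ := key f hf
    rw [← hb, hB b hb', LinearMap.comp_zero]
  | succ i =>
    intro f hf
    obtain ⟨b, hb, hb'⟩ := key f hf
    obtain ⟨g, hg⟩ := hB b hb'
    exact ⟨π ∘ₗ g, by rw [← hb, hg, LinearMap.comp_assoc]⟩

lemma EV.no_torsion [IsLocalRing R] (ε : P 0 →ₗ[R] (R ⧸ maximalIdeal R))
    (hε : Function.Surjective ε)
    (hε0 : ε ∘ₗ p 0 = 0) {Y : Type} [AddCommGroup Y] [Module R Y] (h : EV P p Y 0)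
    (n : ℕ) : ∀ (y : Y), (∀ r ∈ maximalIdeal R ^ n, r • y = 0) → y = 0 := by
  have h1 : ∀ y : Y, (∀ r ∈ maximalIdeal R, r • y = 0) → y = 0 := by
    intro y hy
    let f : (R ⧸ maximalIdeal R) →ₗ[R] Y :=
      Submodule.liftQ _ (LinearMap.toSpanSingleton R Y y) (by
        intro r hr
        simpa using hy r hr)
    have h2 := h (f ∘ₗ ε) (by rw [LinearMap.comp_assoc, hε0, LinearMap.comp_zero])
    obtain ⟨x, hx⟩ := hε (Submodule.Quotient.mk 1)
    have h3 := LinearMap.congr_fun h2 x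
    simp only [LinearMap.comp_apply, hx, LinearMap.zero_apply] at h3
    have h4 : f (Submodule.Quotient.mk 1) = y := by
      exact (Submodule.liftQ_apply _ _ _).trans (one_smul R y)
    rw [← h4, h3]
  induction n with
  | zero => intro y hy; simpa using hy 1 (by simp)
  | succ n ih =>
    intro y hy
    apply ih
    intro r hr
    apply h1
    intro s hs
    rw [smul_smul]
    apply hy
    rw [pow_succ, mul_comm s r]
    exact Ideal.mul_mem_mul hr hs
end

lemma finlen {R : Type} [CommRing R] [IsLocalRing R] {X : Type} [AddCommGroup X] [Module R X]
    (h : IsFiniteLength R X) : ∃ n : ℕ, ∀ r ∈ maximalIdeal R ^ n, ∀ x : X, r • x = 0 := by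
  induction h with
  | of_subsingleton => exact ⟨0, fun r _ x => Subsingleton.elim _ _⟩
  | @of_simple_quotient M _ _ N hs _ ih =>
    obtain ⟨n, hn⟩ := ih
    refine ⟨n + 1, fun r hr x => ?_⟩
    have key : ∀ s ∈ maximalIdeal R, ∀ x : M, s • x ∈ N := by
      intro s hs' x
      obtain ⟨m, hm, ⟨e⟩⟩ := isSimpleModule_iff_quot_maximal.1 hs
      have := eq_maximalIdeal hm
      subst this
      rw [← Submodule.Quotient.mk_eq_zero, Submodule.Quotient.mk_smul]
      apply e.injective
      rw [map_smul, map_zero]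
      obtain ⟨t, ht⟩ := Submodule.Quotient.mk_surjective _ (e (Submodule.Quotient.mk x))
      rw [← ht, ← Submodule.Quotient.mk_smul, Submodule.Quotient.mk_eq_zero]
      exact Ideal.mul_mem_right _ _ hs'
    rw [pow_succ] at hr
    refine Submodule.mul_induction_on hr (fun a ha b hb => ?_) (fun a b ha hb => ?_)
    · rw [mul_smul]
      have := hn a ha ⟨b • x, key b hb x⟩
      exact congrArg Subtype.val this
    · rw [add_smul, ha, hb, add_zero]

section tor
set_option linter.unusedSectionVars false
variable {R : Type} [CommRing R] [IsLocalRing R]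
  (Q : ℕ → Type) [∀ i, AddCommGroup (Q i)] [∀ i, Module R (Q i)]
    (d : ∀ i, Q (i + 1) →ₗ[R] Q i)

/-- `Tor_{i+1}(M,N)` is torsion -/
def TT (M : Type) [AddCommGroup M] [Module R M] (i : ℕ) : Prop :=
  ∀ x : M ⊗[R] Q (i + 1), (d i).lTensor M x = 0 → ∃ n : ℕ, ∀ r ∈ maximalIdeal R ^ n,
    ∃ z, (d (i + 1)).lTensor M z = r • x

/-- `Tor_{i+1}(M,N)` is zero -/
def TZ (M : Type) [AddCommGroup M] [Module R M] (i : ℕ) : Prop :=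
  ∀ x : M ⊗[R] Q (i + 1), (d i).lTensor M x = 0 → ∃ z, (d (i + 1)).lTensor M z = x

variable {Q d} [∀ i, Module.Flat R (Q i)] (hd : ∀ i, Function.Exact (d (i + 1)) (d i))
  {N : Type} [AddCommGroup N] [Module R N] (ε : Q 0 →ₗ[R] N) (hε : Function.Surjective ε)
  (hdε : Function.Exact (d 0) ε)
  {K F M : Type} [AddCommGroup K] [Module R K] [AddCommGroup F] [Module R F] [Module.Flat R F]
  [AddCommGroup M] [Module R M] (ι : K →ₗ[R] F) (π : F →ₗ[R] M)
  (hι : Function.Injective ι) (hex : Function.Exact ι π) (hπ : Function.Surjective π)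

lemma comm' {A B C D : Type} [AddCommGroup A] [Module R A] [AddCommGroup B] [Module R B]
    [AddCommGroup C] [Module R C] [AddCommGroup D] [Module R D] (f : A →ₗ[R] B) (g : C →ₗ[R] D)
    (x : A ⊗[R] C) : f.rTensor D (g.lTensor A x) = g.lTensor B (f.rTensor C x) := by
  rw [← LinearMap.comp_apply, ← LinearMap.comp_apply, LinearMap.rTensor_comp_lTensor,
    LinearMap.lTensor_comp_rTensor]

include hd hι hex hπ

/-- main chase for torsion -/
lemma chaseT (i : ℕ) (hT : TT Q d M i) (x : K ⊗[R] Q i) (y : F ⊗[R] Q (i + 1))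
    (hxy : (d i).lTensor F y = ι.rTensor (Q i) x) :
    ∃ n : ℕ, ∀ r ∈ maximalIdeal R ^ n, ∃ w, (d i).lTensor K w = r • x := by
  have hexi := fun j => rTensor_exact (Q j) hex hπ
  have hinj := Module.Flat.rTensor_preserves_injective_linearMap (M := Q i) ι hι
  obtain ⟨n, hn⟩ := hT (π.rTensor _ y) (by
    rw [← comm', hxy, (hexi _).apply_apply_eq_zero])
  refine ⟨n, fun r hr => ?_⟩
  obtain ⟨z, hz⟩ := hn r hr
  obtain ⟨z', rfl⟩ := LinearMap.rTensor_surjective _ hπ z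
  obtain ⟨w, hw⟩ := (hexi (i + 1) (r • y - (d (i + 1)).lTensor F z')).1 (by
    rw [map_sub, comm', hz, map_smul, sub_self])
  refine ⟨w, hinj ?_⟩
  have h0 := (Module.Flat.lTensor_exact F (hd i)).apply_apply_eq_zero z'
  rw [comm', hw, map_sub, map_smul, hxy, h0, sub_zero, map_smul]

lemma shiftT (i : ℕ) (hT : TT Q d M (i + 1)) : TT Q d K i := by
  intro x hx
  obtain ⟨y, hy⟩ := (Module.Flat.lTensor_exact F (hd i) (ι.rTensor _ x)).1 (by
    rw [← comm', hx, map_zero])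
  exact chaseT hd ι π hι hex hπ _ hT x y hy

lemma chaseZ (i : ℕ) (h : ∀ (x : K ⊗[R] Q i) (y : F ⊗[R] Q (i + 1)),
    (d i).lTensor F y = ι.rTensor (Q i) x → ∃ w, (d i).lTensor K w = x) : TZ Q d M i := by
  have hexi := fun j => rTensor_exact (Q j) hex hπ
  intro u hu
  obtain ⟨y, rfl⟩ := LinearMap.rTensor_surjective _ hπ u
  rw [← comm'] at hu
  obtain ⟨x, hx⟩ := (hexi _ _).1 hu
  obtain ⟨w, hw⟩ := h x y hx.symm
  obtain ⟨z, hz⟩ := (Module.Flat.lTensor_exact F (hd i) (y - ι.rTensor _ w)).1 (by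
    rw [map_sub, ← comm', hw, hx, sub_self])
  refine ⟨π.rTensor _ z, ?_⟩
  rw [← comm', hz, map_sub, (hexi _).apply_apply_eq_zero, sub_zero]

lemma shiftZ (i : ℕ) (hT : TZ Q d K i) : TZ Q d M (i + 1) := by
  have hinj := Module.Flat.rTensor_preserves_injective_linearMap (M := Q i) ι hι
  refine chaseZ hd ι π hι hex hπ _ (fun x y hxy => hT x (hinj ?_))
  rw [comm', ← hxy, (Module.Flat.lTensor_exact F (hd i)).apply_apply_eq_zero, map_zero]

include hε hdε in
lemma base (hT : TT Q d M 0) (hK : ∀ n : ℕ, ∀ y : K ⊗[R] N,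
    (∀ r ∈ maximalIdeal R ^ n, r • y = 0) → y = 0) :
    TZ Q d M 0 ∧ Function.Injective (ι.rTensor N) := by
  have hK0 := lTensor_exact K hdε hε
  have hF0 := lTensor_exact F hdε hε
  have hmain : ∀ (x : K ⊗[R] Q 0) (y : F ⊗[R] Q 1),
      (d 0).lTensor F y = ι.rTensor (Q 0) x → ε.lTensor K x = 0 := by
    intro x y hxy
    obtain ⟨n, hn⟩ := chaseT hd ι π hι hex hπ _ hT x y hxy
    refine hK n _ fun r hr => ?_
    obtain ⟨w, hw⟩ := hn r hr
    rw [← map_smul, ← hw, hK0.apply_apply_eq_zero]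
  refine ⟨chaseZ hd ι π hι hex hπ _ fun x y hxy => (hK0 x).1 (hmain x y hxy), ?_⟩
  rw [injective_iff_map_eq_zero]
  intro x hx
  obtain ⟨x, rfl⟩ := LinearMap.lTensor_surjective _ hε x
  rw [comm'] at hx
  obtain ⟨y, hy⟩ := (hF0 _).1 hx
  exact hmain x y hy

end tor

lemma main {R : Type} [CommRing R] [IsLocalRing R]
    {Q : ℕ → Type} [∀ i, AddCommGroup (Q i)] [∀ i, Module R (Q i)]
    {d : ∀ i, Q (i + 1) →ₗ[R] Q i} [∀ i, Module.Flat R (Q i)]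
    (hd : ∀ i, Function.Exact (d (i + 1)) (d i))
    {N : Type} [AddCommGroup N] [Module R N] (ε : Q 0 →ₗ[R] N) (hε : Function.Surjective ε)
    (hdε : Function.Exact (d 0) ε)
    {P : ℕ → Type} [∀ i, AddCommGroup (P i)] [∀ i, Module R (P i)]
    {p : ∀ i, P (i + 1) →ₗ[R] P i} [∀ i, Module.Projective R (P i)]
    (hp : ∀ i, p i ∘ₗ p (i + 1) = 0)
    (η : P 0 →ₗ[R] (R ⧸ maximalIdeal R)) (hη : Function.Surjective η) (hη0 : η ∘ₗ p 0 = 0)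
    (D : ℕ) (hN : ∀ i < D, EV P p N i) (j : ℕ) :
    ∀ (M : Type) [AddCommGroup M] [Module R M], PdLE R M j → j ≤ D →
      (∀ i, TT Q d M i) → (∀ i, TZ Q d M i) ∧ ∀ i, i + j < D → EV P p (M ⊗[R] N) i := by
  induction j with
  | zero =>
    intro M _ _ ⟨n, del, g, hg, hk, _, hn⟩ _ _
    have hinj : Function.Injective g := by
      rw [← LinearMap.ker_eq_bot, hk, LinearMap.range_eq_bot]
      have : IsEmpty (Fin (n 1)) := by rw [hn 1 (by simp)]; infer_instance
      ext x
      exact this.elim x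
    let e := LinearEquiv.ofBijective g ⟨hinj, hg⟩
    have : Module.Flat R M := Module.Flat.of_linearEquiv e.symm
    refine ⟨fun i x hx => (Module.Flat.lTensor_exact M (hd i) x).1 hx, fun i hi => ?_⟩
    exact ((hN i (by simpa using hi)).free (n 0)).of_equiv (TensorProduct.congr e (.refl R N))
  | succ j ih =>
    intro M _ _ ⟨n, del, g, hg, hk, hdel, hn⟩ hjD hT
    have hex : Function.Exact (LinearMap.ker g).subtype g := LinearMap.exact_subtype_ker_map g
    have hι : Function.Injective (LinearMap.ker g).subtype := Subtype.val_injective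
    obtain ⟨hZ, hE⟩ := ih (LinearMap.ker g) (by
      rw [hk]
      refine ⟨fun i => n (i + 1), fun i => del (i + 1), (del 0).rangeRestrict,
        LinearMap.surjective_rangeRestrict _, ?_, fun i => hdel _, fun i hi => hn _ (by omega)⟩
      rw [LinearMap.ker_rangeRestrict, hdel]) (by omega)
      (fun i => shiftT hd _ g hι hex hg i (hT _))
    obtain ⟨hZ0, hI⟩ := base hd ε hε hdε _ g hι hex hg (hT 0)
      (fun m y hy => (hE 0 (by omega)).no_torsion η hη hη0 m y hy)
    refine ⟨fun i => ?_, fun i hi => ?_⟩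
    · cases i with
      | zero => exact hZ0
      | succ i => exact shiftZ hd _ g hι hex hg i (hZ i)
    · exact EV.ses hp _ _ hI (rTensor_exact N hex hg) (LinearMap.rTensor_surjective _ hg)
        ((hN i (by omega)).free (n 0)) (hE (i + 1) (by omega))

end TV

namespace TV
open CategoryTheory IsLocalRing TensorProduct

lemma res_exact {R : Type} [CommRing R] {N : ModuleCat.{0} R} (Q : ProjectiveResolution N) (i : ℕ) :
    Function.Exact (Q.complex.d (i + 2) (i + 1)).hom (Q.complex.d (i + 1) i).hom :=
  (ShortComplex.ShortExact.moduleCat_exact_iff_function_exact _).1 (Q.exact_succ i)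

lemma res_aug {R : Type} [CommRing R] {N : ModuleCat.{0} R} (Q : ProjectiveResolution N) :
    ∃ ε : Q.complex.X 0 →ₗ[R] N, Function.Surjective ε ∧
      Function.Exact (Q.complex.d 1 0).hom ε := by
  have h1 : Function.Exact (Q.complex.d 1 0).hom (Q.π.f 0).hom :=
    (ShortComplex.ShortExact.moduleCat_exact_iff_function_exact _).1 Q.exact₀
  have h2 : Function.Surjective (Q.π.f 0).hom :=
    (ModuleCat.epi_iff_surjective _).1 inferInstance
  let e := (HomologicalComplex.singleObjXSelf (ComplexShape.down ℕ) 0 N).toLinearEquiv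
  refine ⟨e.toLinearMap ∘ₗ (Q.π.f 0).hom, e.surjective.comp h2, ?_⟩
  intro x
  rw [← h1 x]
  exact e.map_eq_zero_iff

lemma ext_zero {R : Type} [CommRing R] {X : ModuleCat.{0} R} (P : ProjectiveResolution X)
    (Y : Type) [AddCommGroup Y] [Module R Y] (i : ℕ)
    (h : Subsingleton (((Ext R (ModuleCat R) i).obj (Opposite.op X)).obj (ModuleCat.of R Y))) :
    EV (fun i => P.complex.X i) (fun i => (P.complex.d (i + 1) i).hom) Y i := by
  have h0 : Limits.IsZero ((P.complex.linearYonedaObj R (ModuleCat.of R Y)).homology i) :=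
    (ModuleCat.isZero_of_subsingleton _).of_iso (P.isoExt (R := R) i (ModuleCat.of R Y)).symm
  rw [← HomologicalComplex.exactAt_iff_isZero_homology] at h0
  cases i with
  | zero =>
    rw [HomologicalComplex.exactAt_iff' _ 0 0 1 (by simp) (by simp),
      ShortComplex.moduleCat_exact_iff] at h0
    intro f hf
    obtain ⟨g, hg⟩ := h0 (ModuleCat.ofHom f) (ModuleCat.hom_ext hf)
    have h3 : (P.complex.linearYonedaObj R (ModuleCat.of R Y)).d 0 0 = 0 :=
      HomologicalComplex.shape _ _ _ (by simp)
    have h4 := congrArg (fun φ => φ.hom g) h3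
    have h5 := congrArg ModuleCat.Hom.hom (hg.symm.trans h4)
    exact h5
  | succ i =>
    rw [HomologicalComplex.exactAt_iff' _ i (i + 1) (i + 2) (by simp) (by simp),
      ShortComplex.moduleCat_exact_iff] at h0
    intro f hf
    obtain ⟨g, hg⟩ := h0 (ModuleCat.ofHom f) (ModuleCat.hom_ext hf)
    refine ⟨ModuleCat.Hom.hom g, ?_⟩
    exact (congrArg ModuleCat.Hom.hom hg).symm

/-- the short complex computing `Tor_{i+1}` -/
noncomputable def torSC {R : Type} [CommRing R] (M : Type) [AddCommGroup M] [Module R M]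
    {N : ModuleCat.{0} R} (Q : ProjectiveResolution N) (i : ℕ) : ShortComplex (ModuleCat.{0} R) :=
  ShortComplex.moduleCatMk ((Q.complex.d (i + 2) (i + 1)).hom.lTensor M)
    ((Q.complex.d (i + 1) i).hom.lTensor M) (by
      rw [← LinearMap.lTensor_comp, (res_exact Q i).linearMap_comp_eq_zero, LinearMap.lTensor_zero])

noncomputable def torIso {R : Type} [CommRing R] (M N : Type) [AddCommGroup M] [Module R M]
    [AddCommGroup N] [Module R N] (Q : ProjectiveResolution (ModuleCat.of R N)) (i : ℕ) :
    ((Tor (ModuleCat R) (i + 1)).obj (ModuleCat.of R M)).obj (ModuleCat.of R N) ≅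
      (torSC M Q i).homology :=
  Q.isoLeftDerivedObj _ (i + 1) ≪≫ ShortComplex.homologyMapIso
    (HomologicalComplex.natIsoSc' _ _ (i + 2) (i + 1) i (by simp) (by simp) |>.app _)

lemma sc_tors {R : Type} [CommRing R] (S : ShortComplex (ModuleCat.{0} R)) (r : R)
    (h : ∀ x : S.homology, r • x = 0) (x : S.X₂) (hx : S.g x = 0) : ∃ z, S.f z = r • x := by
  let e : S.homology ≃ₗ[R] (LinearMap.ker S.g.hom ⧸ LinearMap.range S.moduleCatToCycles) :=
    S.moduleCatHomologyIso.toLinearEquiv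
  let q : (LinearMap.ker S.g.hom ⧸ LinearMap.range S.moduleCatToCycles) :=
    Submodule.Quotient.mk ⟨x, hx⟩
  have h1 : r • q = 0 := by
    have := h (e.symm q)
    rw [← map_smul] at this
    exact e.symm.map_eq_zero_iff.1 this
  rw [← Submodule.Quotient.mk_smul, Submodule.Quotient.mk_eq_zero] at h1
  obtain ⟨z, hz⟩ := h1
  exact ⟨z, congrArg Subtype.val hz⟩
end TV

theorem tor_vanishing_of_finite_length_and_pd_le_depth
    (R : Type) [CommRing R] [IsNoetherianRing R] [IsLocalRing R]
    (M : Type) [AddCommGroup M] [Module R M] [Module.Finite R M]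
    (N : Type) [AddCommGroup N] [Module R N] [Module.Finite R N]
    (k : ℕ) (hpd : PdLE R M k)
    (hdepth : ∀ i : ℕ, i < k → Subsingleton (ExtM R i (resF R) N))
    (hfl : ∀ i : ℕ, 1 ≤ i → IsFiniteLength R (TorM R i M N)) :
    ∀ i : ℕ, 1 ≤ i → Subsingleton (TorM R i M N) := by

  let Q := projectiveResolution (ModuleCat.of R N)
  let P := projectiveResolution (ModuleCat.of R (resF R))
  obtain ⟨ε, hε, hdε⟩ := TV.res_aug Q
  obtain ⟨η, hη, hdη⟩ := TV.res_aug P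
  have hQ : ∀ i, Module.Projective R (Q.complex.X i) := fun i =>
    (IsProjective.iff_projective _).2 (Q.projective i)
  have hP : ∀ i, Module.Projective R (P.complex.X i) := fun i =>
    (IsProjective.iff_projective _).2 (P.projective i)
  obtain ⟨hZ, -⟩ := TV.main (Q := fun i => Q.complex.X i)
    (d := fun i => (Q.complex.d (i + 1) i).hom) (TV.res_exact Q) ε hε hdε
    (P := fun i => P.complex.X i) (p := fun i => (P.complex.d (i + 1) i).hom)
    (fun i => (TV.res_exact P i).linearMap_comp_eq_zero) η hη hdη.linearMap_comp_eq_zero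
    k (fun i hi => TV.ext_zero P N i (hdepth i hi)) k M hpd le_rfl (by
      intro i x hx
      obtain ⟨n, hn⟩ := TV.finlen (hfl (i + 1) (by omega))
      refine ⟨n, fun r hr => ?_⟩
      refine TV.sc_tors (TV.torSC M Q i) r (fun y => ?_) x hx
      let e := (TV.torIso M N Q i).toLinearEquiv
      obtain ⟨y, rfl⟩ := e.surjective y
      rw [← map_smul, hn r hr, map_zero])
  intro i hi
  obtain ⟨i, rfl⟩ : ∃ j, i = j + 1 := ⟨i - 1, by omega⟩
  have h1 : (TV.torSC M Q i).Exact := (ShortComplex.moduleCat_exact_iff _).2 (hZ i)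
  have h2 := ((ShortComplex.exact_iff_isZero_homology _).1 h1).of_iso (TV.torIso M N Q i)
  exact ModuleCat.subsingleton_of_isZero h2
end
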